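/- arXiv:1911.07666 — 2 statements merged into one kernel-verified Lean document; each statement's English description precedes it below -/
import Mathlib

section
/- Let A_{i,j} (i,j ∈ ℤ) be a double cochain complex of abelian groups, with horizontal differentials h : A_{i,j} → A_{i+1,j} and vertical differentials v : A_{i,j} → A_{i,j+1} satisfying h∘h = 0, v∘v = 0 and v∘h = h∘v. Suppose there exist s,t ∈ ℕ such that: (1) A_{t,−t} = 0 and A_{−s,s} = 0; (2) the rows are exact at A_{i,−i} for all −s < i < t; (3) the columns are exact at A_{1,0}, A_{2,−1}, …, A_{t,1−t} and at A_{−1,0}, A_{−2,1}, …, A_{−s,s−1}. Then the 0-th column is exact at A_{0,0}: every a ∈ A_{0,0} with v(a) = 0 lies in the image of v : A_{0,−1} → A_{0,0}. -/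
/-!
# The grid lemma for double cochain complexes of abelian groups

A double cochain complex of abelian groups is a `ℤ × ℤ`-indexed family `A i j` of abelian
groups together with horizontal differentials `h : A i j →+ A (i+1) j` and vertical
differentials `v : A i j →+ A i (j+1)` satisfying `h ∘ h = 0`, `v ∘ v = 0` and
`v ∘ h = h ∘ v`.

Exactness of a row at `A i j` means `ker (h : A i j → A (i+1) j) = im (h : A (i-1) j → A i j)`,
and similarly for columns with `v`.  To avoid index casts, exactness conditions are stated at
"successor" positions.

The lemma: if `A (t, -t) = 0` and `A (-s, s) = 0`, the rows are exact at `A (i, -i)` for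
`-s < i < t`, and the columns are exact at `A (1,0), A (2,-1), …, A (t,1-t)` and at
`A (-1,0), A (-2,1), …, A (-s,s-1)`, then the `0`-th column is exact at `A (0,0)`:
every `a ∈ A 0 0` with `v a = 0` lies in the image of `v : A 0 (-1) → A 0 0`.
-/

theorem grid_lemma
    (A : ℤ → ℤ → Type*) [∀ i j, AddCommGroup (A i j)]
    (h : ∀ i j, A i j →+ A (i + 1) j)
    (v : ∀ i j, A i j →+ A i (j + 1))
    -- double cochain complex axioms
    (hh : ∀ i j (x : A i j), h (i + 1) j (h i j x) = 0)
    (vv : ∀ i j (x : A i j), v i (j + 1) (v i j x) = 0)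
    (hv : ∀ i j (x : A i j), v (i + 1) j (h i j x) = h i (j + 1) (v i j x))
    (s t : ℕ)
    -- (1) vanishing corners:  A (t, -t) = 0  and  A (-s, s) = 0
    (hcorner₁ : Subsingleton (A (t : ℤ) (-(t : ℤ))))
    (hcorner₂ : Subsingleton (A (-(s : ℤ)) (s : ℤ)))
    -- (2) rows are exact at `A (i, -i)` for `-s < i < t` (written at position `i'+1 = i`)
    (hrows : ∀ i' : ℤ, -(s : ℤ) < i' + 1 → i' + 1 < (t : ℤ) →
      ∀ x : A (i' + 1) (-(i' + 1)), h (i' + 1) (-(i' + 1)) x = 0 →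
        ∃ y : A i' (-(i' + 1)), h i' (-(i' + 1)) y = x)
    -- (3) columns are exact at `A (k, 1-k)` for `1 ≤ k ≤ t` …
    (hcolspos : ∀ k : ℤ, 1 ≤ k → k ≤ (t : ℤ) →
      ∀ x : A k (-k + 1), v k (-k + 1) x = 0 →
        ∃ y : A k (-k), v k (-k) y = x)
    -- … and at `A (-k, k-1)` for `1 ≤ k ≤ s`
    (hcolsneg : ∀ k : ℤ, 1 ≤ k → k ≤ (s : ℤ) →
      ∀ x : A (-k) (k - 2 + 1), v (-k) (k - 2 + 1) x = 0 →
        ∃ y : A (-k) (k - 2), v (-k) (k - 2) y = x) :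
    -- conclusion: the 0-th column is exact at `A (0,0)`
    ∀ a : A 0 0, v 0 0 a = 0 → ∃ b : A 0 (-1), v 0 (-1) b = a := by
  have rows : ∀ i j : ℤ, i + 1 + j = 0 → -(s : ℤ) < i + 1 → i + 1 < (t : ℤ) →
      ∀ x : A (i + 1) j, h (i + 1) j x = 0 → ∃ y : A i j, h i j y = x := by
    intro i j e
    obtain rfl : j = -(i + 1) := by omega
    exact hrows i
  have cpos : ∀ i j : ℤ, i + j = 0 → 1 ≤ i → i ≤ (t : ℤ) →
      ∀ x : A i (j + 1), v i (j + 1) x = 0 → ∃ y : A i j, v i j y = x := by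
    intro i j e
    obtain rfl : j = -i := by omega
    exact hcolspos i
  have cneg : ∀ i j : ℤ, i + j = -2 → i ≤ -1 → -(s : ℤ) ≤ i →
      ∀ x : A i (j + 1), v i (j + 1) x = 0 → ∃ y : A i j, v i j y = x := by
    intro i j e h1 h2
    obtain ⟨k, rfl⟩ : ∃ k, i = -k := ⟨-i, by omega⟩
    obtain rfl : j = k - 2 := by omega
    exact hcolsneg k (by omega) (by omega)
  have c1 : ∀ i j : ℤ, i = t → i + j = 0 → ∀ x : A i j, x = 0 := by
    intro i j e e2 x
    subst e
    obtain rfl : j = -(t : ℤ) := by omega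
    exact Subsingleton.elim _ _
  have c2 : ∀ i j : ℤ, i = -(s : ℤ) → i + j = 0 → ∀ x : A i j, x = 0 := by
    intro i j e e2 x
    subst e
    obtain rfl : j = (s : ℤ) := by omega
    exact Subsingleton.elim _ _
  have P : ∀ (n : ℕ) (i j : ℤ), i + (j + 1) = 0 → 0 ≤ i → i + 1 + n = t →
      ∀ x : A i (j + 1), v (i + 1) (j + 1) (h i (j + 1) x) = 0 →
      ∃ b : A i j, h i (j + 1) (x - v i j b) = 0 := by
    intro n
    induction n with
    | zero =>
      intro i j e h0 hn x hx
      obtain ⟨y, hy⟩ := cpos (i + 1) j (by omega) (by omega) (by omega) _ hx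
      have y0 := c1 (i + 1) j (by omega) (by omega) y
      refine ⟨0, ?_⟩
      rw [map_zero, sub_zero, ← hy, y0, map_zero]
    | succ n ih =>
      intro i j e h0 hn x hx
      obtain ⟨y, hy⟩ := cpos (i + 1) j (by omega) (by omega) (by omega) _ hx
      obtain ⟨j, rfl⟩ : ∃ j', j = j' + 1 := ⟨j - 1, by omega⟩
      obtain ⟨b, hb⟩ := ih (i + 1) j (by omega) (by omega) (by push_cast at hn; omega) y
        (by rw [hv, hy, hh])
      obtain ⟨c, hc⟩ := rows i (j + 1) (by omega) (by omega) (by omega) _ hb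
      refine ⟨c, ?_⟩
      rw [map_sub, ← hv, hc, map_sub, vv, hy, sub_zero, sub_self]
  have N : ∀ (n : ℕ) (i j : ℤ), i + j = -2 → i ≤ -1 → i - n = -(s : ℤ) →
      ∀ x : A i (j + 1), h i (j + 1 + 1) (v i (j + 1) x) = 0 →
      ∃ d : A i j, h i (j + 1) (x - v i j d) = 0 := by
    intro n
    induction n with
    | zero =>
      intro i j e h0 hn x hx
      obtain ⟨d, hd⟩ := cneg i j e h0 (by omega) x (c2 _ _ (by omega) (by omega) _)
      exact ⟨d, by rw [hd, sub_self, map_zero]⟩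
    | succ n ih =>
      intro i j e h0 hn x hx
      push_cast at hn
      obtain ⟨i, rfl⟩ : ∃ i', i = i' + 1 := ⟨i - 1, by omega⟩
      obtain ⟨c, hc⟩ := rows i (j + 1 + 1) (by omega) (by omega) (by omega) _ hx
      obtain ⟨d, hd⟩ := ih i (j + 1) (by omega) (by omega) (by omega) c
        (by rw [← hv, hc, vv])
      have h3 : v (i + 1) (j + 1) (x - h i (j + 1) d) = 0 := by
        rw [map_sub, hv, ← hc, ← map_sub, hd]
      obtain ⟨d', hd'⟩ := cneg (i + 1) j e h0 (by omega) _ h3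
      exact ⟨d', by rw [hd', sub_sub_cancel, hh]⟩
  have F : ∀ i j : ℤ, i + 1 = 0 → j = -1 → ∀ a : A (i + 1) (j + 1),
      v (i + 1) (j + 1) a = 0 → ∃ b : A (i + 1) j, v (i + 1) j b = a := by
    intro i j hi hj a ha
    by_cases ht : t = 0
    · exact ⟨0, by rw [map_zero, c1 _ _ (by omega) (by omega) a]⟩
    by_cases hs : s = 0
    · exact ⟨0, by rw [map_zero, c2 _ _ (by omega) (by omega) a]⟩
    obtain ⟨b, hb⟩ := P (t - 1) (i + 1) j (by omega) (by omega) (by omega) a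
      (by rw [hv, ha, map_zero])
    obtain ⟨c, hc⟩ := rows i (j + 1) (by omega) (by omega) (by omega) _ hb
    obtain ⟨d, hd⟩ := N (s - 1) i j (by omega) (by omega) (by omega) c
      (by rw [← hv, hc, map_sub, ha, vv, sub_zero])
    refine ⟨b + h i j d, ?_⟩
    rw [map_sub, hc, ← hv, sub_sub, sub_eq_zero] at hd
    rw [map_add, hd]
  exact F (-1) (-1) (by norm_num) rfl
end

section
/- Let R be a connected semilocal commutative ring with 2 invertible, let (A,σ) be an Azumaya R-algebra with involution, and let S = Cent(A). Let B be an S-subalgebra of A that is separable projective over R with connected center T, and let τ : B → B be an involution with τ|_S = σ|_S. Then there exist ε ∈ {±1} and a ∈ A^× with σ(a) = ε·a such that τ(b) = a·σ(b)·a^{−1} for all b ∈ B. Moreover, if τ|_T ≠ id_T, then for each prescribed ε ∈ {±1} such an a can be found. -/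
open TensorProduct

noncomputable section

/-- A commutative ring is semilocal if it has only finitely many maximal ideals. -/
def IsSemilocalRing (R : Type*) [CommRing R] : Prop :=
  {I : Ideal R | I.IsMaximal}.Finite

/-- A nonzero commutative ring is connected if its only idempotents are `0` and `1`. -/
def IsConnectedRing (R : Type*) [CommRing R] : Prop :=
  (0 : R) ≠ 1 ∧ ∀ e : R, IsIdempotentElem e → e = 0 ∨ e = 1

/-- An `R`-algebra `A` is separable iff it admits a separability idempotent. -/
def IsSeparableAlgebra (R : Type*) [CommRing R] (A : Type*) [Ring A] [Algebra R A] : Prop :=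
  ∃ e : A ⊗[R] A, LinearMap.mul' R A e = 1 ∧
    ∀ b : A, LinearMap.rTensor A (LinearMap.mulLeft R b) e
           = LinearMap.lTensor A (LinearMap.mulRight R b) e

/-- A ring involution: an additive, anti-multiplicative, unital map of order two. -/
structure RingInvolution (A : Type*) [Ring A] where
  toFun : A → A
  map_add' : ∀ a b, toFun (a + b) = toFun a + toFun b
  map_mul' : ∀ a b, toFun (a * b) = toFun b * toFun a
  map_one' : toFun 1 = 1
  invol' : ∀ a, toFun (toFun a) = a

/-- `R`-linearity of a ring involution on an `R`-algebra. -/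
def RingInvolution.IsLinear (R : Type*) [CommRing R] {A : Type*} [Ring A] [Algebra R A]
    (σ : RingInvolution A) : Prop :=
  ∀ (r : R) (a : A), σ.toFun (r • a) = r • σ.toFun a

/-- `(A, σ)` is an Azumaya `R`-algebra with involution: `A` is separable over `R` and finite
projective as an `R`-module, `σ` is an `R`-linear ring involution of `A`, and `r ↦ r·1_A`
identifies `R` with the `σ`-fixed subring of the center of `A`. -/
def IsAzumayaAlgebraWithInvolution (R : Type*) [CommRing R] (A : Type*) [Ring A] [Algebra R A]
    (σ : RingInvolution A) : Prop :=
  IsSeparableAlgebra R A ∧ Module.Finite R A ∧ Module.Projective R A ∧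
  σ.IsLinear R ∧
  Function.Injective (algebraMap R A) ∧
  ∀ a : A, ((a ∈ Subalgebra.center R A) ∧ σ.toFun a = a) ↔ a ∈ (algebraMap R A).range

open TensorProduct
noncomputable section

/-- separability family -/
def SepFam (R : Type*) [CommRing R] {A : Type*} [Ring A] [Algebra R A] {n : ℕ}
    (x y : Fin n → A) : Prop :=
  ∑ i, x i * y i = 1 ∧ ∀ b : A, ∑ i, (b * x i) ⊗ₜ[R] y i = ∑ i, x i ⊗ₜ[R] (y i * b)

theorem IsSeparableAlgebra.exists_fam {R : Type*} [CommRing R] {A : Type*} [Ring A] [Algebra R A]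
    (h : IsSeparableAlgebra R A) : ∃ (n : ℕ) (x y : Fin n → A), SepFam R x y := by
  obtain ⟨e, h1, h2⟩ := h
  obtain ⟨n, x, y, rfl⟩ : ∃ (n : ℕ) (x y : Fin n → A), e = ∑ i, x i ⊗ₜ[R] y i := by
    obtain ⟨S, hS⟩ := TensorProduct.exists_finset e
    refine ⟨S.card, fun i => (S.equivFin.symm i).1.1, fun i => (S.equivFin.symm i).1.2, ?_⟩
    rw [hS, ← Finset.sum_coe_sort, ← S.equivFin.symm.sum_comp]
  refine ⟨n, x, y, ?_, fun b => ?_⟩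
  · simpa using h1
  · simpa using h2 b

theorem SepFam.bil {R : Type*} [CommRing R] {A : Type*} [Ring A] [Algebra R A] {n : ℕ}
    {x y : Fin n → A} (h : SepFam R x y) {M : Type*} [AddCommGroup M] [Module R M]
    (g : A →ₗ[R] A →ₗ[R] M) (b : A) :
    ∑ i, g (b * x i) (y i) = ∑ i, g (x i) (y i * b) := by
  have := congrArg (TensorProduct.lift g) (h.2 b)
  simpa using this

theorem SepFam.central {R : Type*} [CommRing R] {A : Type*} [Ring A] [Algebra R A] {n : ℕ}
    {x y : Fin n → A} (h : SepFam R x y) (z b : A) :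
    b * ∑ i, x i * z * y i = (∑ i, x i * z * y i) * b := by
  have := h.bil ((LinearMap.mul R A).compl₁₂ (LinearMap.mulRight R z) LinearMap.id) b
  simp only [LinearMap.compl₁₂_apply, LinearMap.mulRight_apply, LinearMap.mul_apply', LinearMap.id_coe, id] at this
  rw [Finset.mul_sum, Finset.sum_mul]
  simpa [mul_assoc] using this

section field
variable {K : Type*} [Field K] {D : Type*} [Ring D] [Algebra K D]
  {B : Type*} [Ring B] [Algebra K B]

theorem SepFam.avg {n : ℕ} {x y : Fin n → B} (h : SepFam K x y) (f g : B →ₐ[K] D) (z : D) (b : B) :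
    f b * ∑ i, f (x i) * z * g (y i) = (∑ i, f (x i) * z * g (y i)) * g b := by
  have := h.bil ((LinearMap.mul K D).compl₁₂ (LinearMap.mulRight K z ∘ₗ f.toLinearMap) g.toLinearMap) b
  simp only [LinearMap.compl₁₂_apply, LinearMap.mulRight_apply, LinearMap.mul_apply',
    LinearMap.comp_apply, AlgHom.toLinearMap_apply] at this
  rw [Finset.mul_sum, Finset.sum_mul]
  simpa [mul_assoc] using this

/-- right-linear average of a linear map -/
theorem SepFam.ravg {n : ℕ} {a c : Fin n → D} (h : SepFam K a c) (f : D →ₗ[K] D) (m : D) :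
    ∑ j, f (m * a j) * c j = (∑ j, f (a j) * c j) * m := by
  have := h.bil ((LinearMap.mul K D).compl₁₂ f LinearMap.id) m
  simp only [LinearMap.compl₁₂_apply, LinearMap.mul_apply', LinearMap.id_coe, id] at this
  rw [this, Finset.sum_mul]
  simp [mul_assoc]

theorem exists_pseudo_inverse {V W : Type*} [AddCommGroup V] [Module K V] [AddCommGroup W] [Module K W]
    (f : V →ₗ[K] W) : ∃ g : W →ₗ[K] V, ∀ v, f (g (f v)) = f v := by
  obtain ⟨s, hs⟩ := f.rangeRestrict.exists_rightInverse_of_surjective f.range_rangeRestrict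
  obtain ⟨r, hr⟩ := (LinearMap.range f).subtype.exists_leftInverse_of_injective (by simp)
  refine ⟨s ∘ₗ r, fun v => ?_⟩
  have h1 : r (f v) = f.rangeRestrict v := by
    have := LinearMap.congr_fun hr (f.rangeRestrict v)
    simpa using this
  have h2 := LinearMap.congr_fun hs (f.rangeRestrict v)
  simp only [LinearMap.comp_apply, h1]
  exact congrArg Subtype.val h2

theorem lemmaM {n n' : ℕ} {x y : Fin n → B} (hB : SepFam K x y) {a c : Fin n' → D}
    (hD : SepFam K a c) (f g : B →ₐ[K] D) (z : D) (hz : ∀ b, f b * z = z * g b) :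
    ∃ w : D, (∀ b, g b * w = w * f b) ∧ z * w * z = z := by
  obtain ⟨f0, hf0⟩ := exists_pseudo_inverse (LinearMap.mulLeft K z)
  simp only [LinearMap.mulLeft_apply] at hf0
  set w0 := ∑ j, f0 (a j) * c j with hw0
  have h0 : z * w0 * z = z := by
    rw [mul_assoc, hw0, ← hD.ravg f0 z, Finset.mul_sum]
    calc _ = ∑ j, z * a j * c j := by
          refine Finset.sum_congr rfl fun j _ => ?_
          rw [← mul_assoc, hf0]
      _ = z := by simp_rw [mul_assoc]; rw [← Finset.mul_sum, hD.1, mul_one]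
  refine ⟨∑ i, g (x i) * w0 * f (y i), fun b => hB.avg g f w0 b, ?_⟩
  calc z * (∑ i, g (x i) * w0 * f (y i)) * z = ∑ i, f (x i) * f (y i) * z := by
        rw [Finset.mul_sum, Finset.sum_mul]
        refine Finset.sum_congr rfl fun i _ => ?_
        calc z * (g (x i) * w0 * f (y i)) * z = (z * g (x i)) * w0 * (f (y i) * z) := by noncomm_ring
          _ = f (x i) * (z * w0 * z) * g (y i) := by rw [← hz (x i), hz (y i)]; simp only [mul_assoc]
          _ = _ := by rw [h0, mul_assoc, ← hz, mul_assoc]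
    _ = z := by
        simp_rw [← map_mul]
        rw [← Finset.sum_mul, ← map_sum, hB.1, map_one, one_mul]

theorem lemmaLA {Q U : Type*} [AddCommGroup Q] [Module K Q] [AddCommGroup U] [Module K U]
    [FiniteDimensional K Q] {ι : Type*} [Fintype ι] (x y : ι → Q) (I J : Submodule K Q)
    (h : ∀ κ : (Q ⧸ I) →ₗ[K] K, ∑ i, κ (I.mkQ (x i)) • y i ∈ J)
    (g : Q →ₗ[K] Q →ₗ[K] U) (Z : Submodule K U) (h1 : ∀ p ∈ I, ∀ q, g p q ∈ Z)
    (h2 : ∀ p, ∀ q ∈ J, g p q ∈ Z) : ∑ i, g (x i) (y i) ∈ Z := by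
  let b := Module.finBasis K (Q ⧸ I)
  choose l hl using fun j => I.mkQ_surjective (b j)
  have hx : ∀ i, x i - ∑ j, b.coord j (I.mkQ (x i)) • l j ∈ I := by
    intro i
    rw [← (Submodule.Quotient.mk_eq_zero I), ← Submodule.mkQ_apply, map_sub, map_sum]
    simp only [map_smul, hl, Module.Basis.coord_apply, Module.Basis.sum_repr, sub_self]
  have : ∑ i, g (x i) (y i) = ∑ i, g (x i - ∑ j, b.coord j (I.mkQ (x i)) • l j) (y i)
      + ∑ j, g (l j) (∑ i, b.coord j (I.mkQ (x i)) • y i) := by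
    have e : ∑ j, g (l j) (∑ i, b.coord j (I.mkQ (x i)) • y i)
        = ∑ i, g (∑ j, b.coord j (I.mkQ (x i)) • l j) (y i) := by
      simp only [map_sum, map_smul, LinearMap.sum_apply, LinearMap.smul_apply]
      exact Finset.sum_comm
    rw [e, ← Finset.sum_add_distrib]
    refine Finset.sum_congr rfl fun i _ => ?_
    rw [← LinearMap.add_apply, ← map_add, sub_add_cancel]
  rw [this]
  exact Z.add_mem (Z.sum_mem fun i _ => h1 _ (hx i) _) (Z.sum_mem fun j _ => h2 _ _ (h _))

/-- two sided action -/
def rho (f : B →ₐ[K] D) : (B ⊗[K] Dᵐᵒᵖ) →ₐ[K] Module.End K D :=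
  (AlgHom.mulLeftRight K D).comp (Algebra.TensorProduct.map f (AlgHom.id K _))

theorem rho_apply (f : B →ₐ[K] D) (b : B) (d n : D) :
    rho f (b ⊗ₜ MulOpposite.op d) n = f b * n * d := by
  simp [rho]

theorem rho_comm (f : B →ₐ[K] D) (u : D) (hu : ∀ b, f b * u = u * f b) (q : B ⊗[K] Dᵐᵒᵖ) (n : D) :
    rho f q (u * n) = u * rho f q n := by
  induction q with
  | zero => simp
  | tmul b d =>
    induction d using MulOpposite.rec' with
    | _ d => rw [rho_apply, rho_apply, ← mul_assoc, hu]; simp only [mul_assoc]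
  | add p q hp hq => simp [hp, hq, mul_add]

theorem lemmaH {n n' : ℕ} {x y : Fin n → B} (hB : SepFam K x y) {a c : Fin n' → D}
    (hD : SepFam K a c) [FiniteDimensional K B] [FiniteDimensional K D] (f g : B →ₐ[K] D)
    (hS : ∀ s ∈ Subalgebra.center K D, ∃ t ∈ Subalgebra.center K B, f t = s ∧ g t = s)
    (u p : D) (hu : ∀ b, f b * u = u * f b) (hp : ∀ b, g b * p = p * g b)
    (h0 : ∀ h, (∀ b, f b * h = h * g b) → u * h * p = 0) :
    ∃ t ∈ Subalgebra.center K B, f t * u = 0 ∧ g t * p = p := by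
  let I2 : Submodule K (B ⊗[K] Dᵐᵒᵖ) :=
    LinearMap.ker ((LinearMap.mulRight K (LinearMap.mulLeft K u : Module.End K D)) ∘ₗ (rho f).toLinearMap)
  let I1 : Submodule K (B ⊗[K] Dᵐᵒᵖ) :=
    LinearMap.ker ((LinearMap.mulRight K (LinearMap.mulLeft K p : Module.End K D)) ∘ₗ (rho g).toLinearMap)
  have hI2 : ∀ q, q ∈ I2 ↔ ∀ m, rho f q (u * m) = 0 := by
    intro q
    simp only [I2, LinearMap.mem_ker, LinearMap.comp_apply, AlgHom.toLinearMap_apply,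
      LinearMap.mulRight_apply, LinearMap.ext_iff, Module.End.mul_apply, LinearMap.mulLeft_apply,
      LinearMap.zero_apply]
  have hI1 : ∀ q, q ∈ I1 ↔ ∀ m, rho g q (p * m) = 0 := by
    intro q
    simp only [I1, LinearMap.mem_ker, LinearMap.comp_apply, AlgHom.toLinearMap_apply,
      LinearMap.mulRight_apply, LinearMap.ext_iff, Module.End.mul_apply, LinearMap.mulLeft_apply,
      LinearMap.zero_apply]
  let X : Fin n × Fin n' → B ⊗[K] Dᵐᵒᵖ := fun ij => x ij.1 ⊗ₜ MulOpposite.op (c ij.2)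
  let Y : Fin n × Fin n' → B ⊗[K] Dᵐᵒᵖ := fun ij => y ij.1 ⊗ₜ MulOpposite.op (a ij.2)
  have hXY : ∑ ij, X ij * Y ij = 1 := by
    simp only [X, Y, Algebra.TensorProduct.tmul_mul_tmul, ← MulOpposite.op_mul]
    rw [Fintype.sum_prod_type]
    simp only [← TensorProduct.tmul_sum]
    rw [← TensorProduct.sum_tmul, ← Finset.op_sum, hB.1, hD.1]
    rfl
  have key : ∀ (l : D →ₗ[K] K) (m : D), ∑ ij, l (rho g (Y ij) (p * m)) • X ij ∈ I2 := by
    intro l m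
    rw [hI2]
    intro k
    let F0 : D →ₗ[K] D := l.smulRight k
    have h1 := h0 _ (fun b => hB.avg f g (∑ j, F0 (a j) * c j) b)
    rw [map_sum, LinearMap.sum_apply, Fintype.sum_prod_type]
    calc _ = ∑ i, f (x i) * u * (∑ j, F0 (a j) * c j) * (g (y i) * p * m) := by
          refine Finset.sum_congr rfl fun i _ => ?_
          rw [mul_assoc _ (∑ j, _), ← hD.ravg F0, Finset.mul_sum]
          refine Finset.sum_congr rfl fun j _ => ?_
          simp only [X, Y, map_smul, LinearMap.smul_apply, rho_apply, F0, LinearMap.smulRight_apply]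
          simp only [mul_assoc, smul_mul_assoc, mul_smul_comm]
      _ = u * (∑ i, f (x i) * (∑ j, F0 (a j) * c j) * g (y i)) * p * m := by
          rw [Finset.mul_sum, Finset.sum_mul, Finset.sum_mul]
          refine Finset.sum_congr rfl fun i _ => ?_
          rw [hu]
          simp only [mul_assoc]
      _ = 0 := by rw [h1, zero_mul]
  have h1 : (1 : B ⊗[K] Dᵐᵒᵖ) ∈ I2 ⊔ I1 := by
    rw [← hXY]
    refine lemmaLA X Y I2 I1 (fun κ => ?_) (LinearMap.mul K _) _ ?_ ?_
    · rw [hI1]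
      intro m
      refine (Module.forall_dual_apply_eq_zero_iff K _).1 fun l => ?_
      have := congrArg κ ((Submodule.Quotient.mk_eq_zero I2).2 (key l m))
      rw [← Submodule.mkQ_apply, map_sum, map_sum, map_zero] at this
      rw [map_sum, LinearMap.sum_apply, map_sum, ← this]
      refine Finset.sum_congr rfl fun ij _ => ?_
      simp only [map_smul, LinearMap.smul_apply, smul_eq_mul]
      rw [mul_comm]
    · intro q hq r
      refine Submodule.mem_sup_left ?_
      rw [hI2] at hq ⊢
      intro m
      rw [LinearMap.mul_apply', map_mul (rho _), Module.End.mul_apply, rho_comm f u hu, hq]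
    · intro r q hq
      refine Submodule.mem_sup_right ?_
      rw [hI1] at hq ⊢
      intro m
      rw [LinearMap.mul_apply', map_mul (rho _), Module.End.mul_apply, hq, map_zero]
  obtain ⟨α, hα, β, hβ, hαβ⟩ := Submodule.mem_sup.1 h1
  rw [hI2] at hα
  rw [hI1] at hβ
  have psi : ∀ (f : B →ₐ[K] D) (v : D), (∀ b, f b * v = v * f b) → ∀ (q : B ⊗[K] Dᵐᵒᵖ),
      ∑ i, ∑ j, f (x i) * rho f q (v * (f (y i) * a j)) * c j
      = (∑ i, ∑ j, f (x i) * rho f q (f (y i) * a j) * c j) * v := by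
    intro f v hv q
    induction q with
    | zero => simp
    | add p q hp hq => simp only [map_add, LinearMap.add_apply, mul_add, add_mul, Finset.sum_add_distrib, hp, hq]
    | tmul b d =>
      induction d using MulOpposite.rec' with
      | _ d =>
        have e : ∀ w, ∑ i, ∑ j, f (x i) * (rho f (b ⊗ₜ[K] MulOpposite.op d)) (w * (f (y i) * a j)) * c j
            = (∑ i, f (x i) * f b * w * f (y i)) * ∑ j, a j * d * c j := by
          intro w
          simp only [rho_apply, Finset.sum_mul, Finset.mul_sum, mul_assoc]
          exact Finset.sum_comm
        have e1 := e 1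
        simp only [one_mul, mul_one] at e1
        rw [e, e1, mul_assoc _ _ v, ← hD.central d v, ← mul_assoc, Finset.sum_mul (f := fun i => f (x i) * f b * f (y i))]
        congr 1
        refine Finset.sum_congr rfl fun i _ => ?_
        rw [mul_assoc _ v, mul_assoc _ (f (y i)), hv]
  have ht : ∀ q : B ⊗[K] Dᵐᵒᵖ, ∃ t ∈ Subalgebra.center K B,
      f t = ∑ i, ∑ j, f (x i) * rho f q (f (y i) * a j) * c j ∧
      g t = ∑ i, ∑ j, g (x i) * rho g q (g (y i) * a j) * c j := by
    intro q
    induction q with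
    | zero => exact ⟨0, Subalgebra.zero_mem _, by simp, by simp⟩
    | add p q hp hq =>
      obtain ⟨t, h1, h2, h3⟩ := hp
      obtain ⟨t', h1', h2', h3'⟩ := hq
      refine ⟨t + t', Subalgebra.add_mem _ h1 h1', ?_, ?_⟩
      · simp only [map_add, LinearMap.add_apply, mul_add, add_mul, Finset.sum_add_distrib, h2, h2']
      · simp only [map_add, LinearMap.add_apply, mul_add, add_mul, Finset.sum_add_distrib, h3, h3']
    | tmul b d =>
      induction d using MulOpposite.rec' with
      | _ d =>
        have e : ∀ f : B →ₐ[K] D, ∑ i, ∑ j, f (x i) * (rho f (b ⊗ₜ[K] MulOpposite.op d)) (f (y i) * a j) * c j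
            = f (∑ i, x i * b * y i) * ∑ j, a j * d * c j := by
          intro f
          simp only [rho_apply, map_sum, map_mul, Finset.sum_mul, Finset.mul_sum, mul_assoc]
          exact Finset.sum_comm
        obtain ⟨t, h1, h2, h3⟩ := hS (∑ j, a j * d * c j)
          (Subalgebra.mem_center_iff.2 fun z => hD.central d z)
        refine ⟨(∑ i, x i * b * y i) * t, Subalgebra.mul_mem _
          (Subalgebra.mem_center_iff.2 fun z => hB.central b z) h1, ?_, ?_⟩
        · rw [e, map_mul, h2]
        · rw [e, map_mul, h3]
  obtain ⟨t, h1, h2, h3⟩ := ht α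
  refine ⟨t, h1, ?_, ?_⟩
  · rw [h2, ← psi f u hu]
    simp [hα]
  · rw [h3, ← psi g p hp]
    have : α = 1 - β := eq_sub_of_add_eq hαβ
    have h4 : ∀ m, rho g α (p * m) = p * m := by
      intro m
      rw [this, map_sub, map_one, LinearMap.sub_apply, hβ, sub_zero]; rfl
    simp only [h4]
    calc _ = p * ((∑ i, g (x i) * g (y i)) * ∑ j, a j * c j) := by
          simp only [Finset.sum_mul, Finset.mul_sum]
          rw [Finset.sum_comm]
          refine Finset.sum_congr rfl fun i _ => Finset.sum_congr rfl fun j _ => ?_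
          rw [← mul_assoc, hp]
          simp only [mul_assoc]
      _ = p := by
          simp_rw [← map_mul]
          rw [← map_sum, hB.1, hD.1, map_one, mul_one, mul_one]

end field
end

open TensorProduct
noncomputable section
section field2
section ring2
variable {K : Type*} [CommRing K] {D : Type*} [Ring D] [Algebra K D]
  {B : Type*} [Ring B] [Algebra K B]

/-- intertwiners -/
def Ed (f g : B →ₐ[K] D) : Submodule K D where
  carrier := {h | ∀ b, f b * h = h * g b}
  add_mem' := fun {x y} hx hy b => by rw [mul_add, add_mul, hx b, hy b]
  zero_mem' := fun b => by simp
  smul_mem' := fun c x hx b => by rw [mul_smul_comm, hx b, smul_mul_assoc]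

/-- symmetric intertwiners -/
def Ee (f g : B →ₐ[K] D) (s : D →ₗ[K] D) (δ : K) : Submodule K D where
  carrier := {h | h ∈ Ed f g ∧ s h = δ • h}
  add_mem' := fun {x y} hx hy => ⟨Submodule.add_mem _ hx.1 hy.1, by rw [map_add, hx.2, hy.2, smul_add]⟩
  zero_mem' := ⟨Submodule.zero_mem _, by simp⟩
  smul_mem' := fun c x hx => ⟨Submodule.smul_mem _ _ hx.1, by rw [map_smul, hx.2, smul_comm]⟩

theorem mem_Ed {f g : B →ₐ[K] D} {h : D} : h ∈ Ed f g ↔ ∀ b, f b * h = h * g b := Iff.rfl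
theorem mem_Ee {f g : B →ₐ[K] D} {s : D →ₗ[K] D} {δ : K} {h : D} :
    h ∈ Ee f g s δ ↔ h ∈ Ed f g ∧ s h = δ • h := Iff.rfl

theorem Ed_mul {f g : B →ₐ[K] D} {h c c' : D} (hh : h ∈ Ed f g) (hc : ∀ b, f b * c = c * f b)
    (hc' : ∀ b, g b * c' = c' * g b) : c * h * c' ∈ Ed f g := by
  intro b
  rw [← mul_assoc, ← mul_assoc, hc, mul_assoc c, hh b, mul_assoc _ _ (g b), ← hc']
  simp only [mul_assoc]

end ring2
variable {K : Type*} [Field K] {D : Type*} [Ring D] [Algebra K D]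
  {B : Type*} [Ring B] [Algebra K B]
variable [FiniteDimensional K B] [FiniteDimensional K D]

theorem field_p_zero {n n' : ℕ} {x y : Fin n → B} (hB : SepFam K x y) {a' c' : Fin n' → D}
    (hD : SepFam K a' c') (f g : B →ₐ[K] D)
    (hS : ∀ s ∈ Subalgebra.center K D, ∃ t ∈ Subalgebra.center K B, f t = s ∧ g t = s)
    (s : D →ₗ[K] D) (hs1 : s 1 = 1) (hsm : ∀ a b, s (a * b) = s b * s a) (hss : ∀ a, s (s a) = a)
    (hτ : ∀ b, ∃ b', g b' = s (f b) ∧ f b' = s (g b))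
    (hr : ∀ t ∈ Subalgebra.center K B, Module.finrank K (LinearMap.range (LinearMap.mulLeft K (f t)))
      = Module.finrank K (LinearMap.range (LinearMap.mulLeft K (g t))))
    (δ : K) (hδ : δ * δ = 1) (a w p : D) (ha : a ∈ Ee f g s δ) (hw : ∀ b, g b * w = w * f b)
    (haw : a * w * a = a) (hp : p = 1 - w * a) (hpc : ∀ b, g b * p = p * g b)
    (hspc : ∀ b, f b * s p = s p * f b) (h0 : ∀ h ∈ Ed f g, s p * h * p = 0) : p = 0 := by
  obtain ⟨t, htc, ht1, ht2⟩ := lemmaH hB hD f g hS (s p) p hspc hpc h0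
  have hap : a * p = 0 := by rw [hp, mul_sub, mul_one, ← mul_assoc, haw, sub_self]
  have hsa := ha.2
  have h1 : (1 - a * w) * a = 0 := by rw [sub_mul, haw, one_mul, sub_self]
  have h2 : a * s (1 - a * w) = 0 := by
    have := congrArg s h1
    rw [hsm, hsa, map_zero, smul_mul_assoc] at this
    have h3 := congrArg (fun z => δ • z) this
    simpa [smul_smul, hδ] using h3
  have h3 : s (1 - a * w) = p * s (1 - a * w) := by
    rw [hp, sub_mul, mul_assoc w, h2, mul_zero, sub_zero, one_mul]
  have h4 : 1 - a * w = (1 - a * w) * s p := by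
    have := congrArg s h3
    rwa [hsm, hss] at this
  have h5 : 1 - s p = a * w * (1 - s p) := by
    have : (1 - a * w) * (1 - s p) = 0 := by rw [mul_sub, mul_one, ← h4, sub_self]
    rw [sub_mul, one_mul] at this
    exact sub_eq_zero.1 this
  have h6 : f t = a * (g t * (w * (1 - s p))) := by
    calc f t = f t * (1 - s p) := by rw [mul_sub, ht1, mul_one, sub_zero]
      _ = (f t * a) * w * (1 - s p) := by conv_lhs => rw [h5]
                                          simp only [mul_assoc]
      _ = _ := by rw [ha.1 t]; simp only [mul_assoc]
  set G := LinearMap.range (LinearMap.mulLeft K (g t)) with hG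
  let φ : G →ₗ[K] D := (LinearMap.mulLeft K a).domRestrict G
  have h7 : LinearMap.range φ = LinearMap.range (LinearMap.mulLeft K (f t)) := by
    apply le_antisymm
    · rintro _ ⟨⟨_, z, rfl⟩, rfl⟩
      refine ⟨a * z, ?_⟩
      simp only [φ, LinearMap.domRestrict_apply, LinearMap.mulLeft_apply]
      rw [← mul_assoc, ha.1 t, mul_assoc]
    · rintro _ ⟨z, rfl⟩
      refine ⟨⟨g t * (w * (1 - s p) * z), ⟨_, rfl⟩⟩, ?_⟩
      simp only [φ, LinearMap.domRestrict_apply, LinearMap.mulLeft_apply]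
      conv_rhs => rw [h6]
      simp only [mul_assoc]
  have h8 := LinearMap.finrank_range_add_finrank_ker φ
  rw [h7, hr t htc, ← hG] at h8
  have h9 : LinearMap.ker φ = ⊥ := Submodule.finrank_eq_zero.1 (by omega)
  have h10 : (⟨p, ⟨p, ht2⟩⟩ : G) ∈ LinearMap.ker φ := by
    simpa [φ] using hap
  rw [h9, Submodule.mem_bot] at h10
  exact congrArg Subtype.val h10

theorem field_caseA {n n' : ℕ} {x y : Fin n → B} (hB : SepFam K x y) {a' c' : Fin n' → D}
    (hD : SepFam K a' c') (f g : B →ₐ[K] D)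
    (hS : ∀ s ∈ Subalgebra.center K D, ∃ t ∈ Subalgebra.center K B, f t = s ∧ g t = s)
    (s : D →ₗ[K] D) (hs1 : s 1 = 1) (hsm : ∀ a b, s (a * b) = s b * s a) (hss : ∀ a, s (s a) = a)
    (hτ : ∀ b, ∃ b', g b' = s (f b) ∧ f b' = s (g b))
    (hr : ∀ t ∈ Subalgebra.center K B, Module.finrank K (LinearMap.range (LinearMap.mulLeft K (f t)))
      = Module.finrank K (LinearMap.range (LinearMap.mulLeft K (g t))))
    (δ : K) (hδ : δ * δ = 1)
    (hcase : ∀ p : D, p * p = p → (∀ b, g b * p = p * g b) → (∀ b, f b * s p = s p * f b) →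
      (∀ h ∈ Ed f g, s (s p * h * p) = - (δ • (s p * h * p))) → (∃ h ∈ Ed f g, s p * h * p ≠ 0) → False) :
    ∃ a ∈ Ee f g s δ, IsUnit a := by
  classical
  obtain ⟨a, ha, hmin⟩ := (measure (fun a : D => Module.finrank K (LinearMap.ker (LinearMap.mulLeft K a)))).wf.has_min
    {a | a ∈ Ee f g s δ} ⟨0, (Ee f g s δ).zero_mem⟩
  have ha : a ∈ Ee f g s δ := ha
  have hmin : ∀ z ∈ Ee f g s δ, Module.finrank K (LinearMap.ker (LinearMap.mulLeft K a)) ≤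
      Module.finrank K (LinearMap.ker (LinearMap.mulLeft K z)) := fun z hz => not_lt.1 (hmin z hz)
  obtain ⟨w, hw, haw⟩ := lemmaM hB hD f g a ha.1
  obtain ⟨p, hp⟩ : ∃ p, p = 1 - w * a := ⟨_, rfl⟩
  have hwaI : w * a * (w * a) = w * a := by rw [mul_assoc, ← mul_assoc a, haw]
  have hpp : p * p = p := by
    rw [hp, sub_mul, mul_sub, mul_sub, hwaI]; simp
  have hap : a * p = 0 := by rw [hp, mul_sub, mul_one, ← mul_assoc, haw, sub_self]
  have hpc : ∀ b, g b * p = p * g b := by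
    intro b
    rw [hp, mul_sub, sub_mul, ← mul_assoc, hw, mul_assoc w, ha.1 b, mul_one, one_mul, mul_assoc w]
  have hspc : ∀ b, f b * s p = s p * f b := by
    intro b
    obtain ⟨b', h1, h2⟩ := hτ b
    have := congrArg s (hpc b')
    rw [hsm, hsm, h1, hss] at this
    exact this.symm
  have hsE : ∀ h ∈ Ed f g, s h ∈ Ed f g := by
    intro h hh b
    obtain ⟨b', h1, h2⟩ := hτ b
    have := congrArg s (hh b')
    rw [hsm, hsm, h1, h2, hss, hss] at this
    exact this.symm
  have hsd : ∀ z, s (δ • z) = δ • s z := fun z => map_smul _ _ _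
  have hspa : s p * a = 0 := by
    have := congrArg s hap
    rw [hsm, ha.2, map_zero, mul_smul_comm] at this
    have h3 := congrArg (fun z => δ • z) this
    simpa [smul_smul, hδ] using h3
  have hspp : s p * s p = s p := by rw [← hsm, hpp]
  have hpure : ∀ h ∈ Ed f g, s (s p * h * p) = - (δ • (s p * h * p)) := by
    intro h hh
    have hss' : s (s p * h * p) = s p * s h * p := by rw [hsm, hsm, hss, mul_assoc]
    let c := s p * (h + δ • s h) * p
    have hcE : c ∈ Ed f g := Ed_mul (Submodule.add_mem _ hh (Submodule.smul_mem _ _ (hsE h hh))) hspc hpc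
    have hcs : s c = δ • c := by
      simp only [c]
      rw [hsm, hsm, hss, map_add, map_smul, hss, ← mul_assoc, smul_mul_assoc .. |>.symm, ← mul_smul_comm,
        smul_add, smul_smul, hδ, one_smul, add_comm]
    have hcp : c * p = c := by simp only [c]; rw [mul_assoc, hpp]
    have hsc : s p * c = c := by simp only [c]; rw [← mul_assoc, ← mul_assoc, hspp]
    have hle : LinearMap.ker (LinearMap.mulLeft K (a + c)) ≤ LinearMap.ker (LinearMap.mulLeft K a) := by
      intro z hz
      simp only [LinearMap.mem_ker, LinearMap.mulLeft_apply] at hz ⊢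
      have h1 : c * z = 0 := by
        have := congrArg (fun v => s p * v) hz
        simp only [mul_zero] at this
        rwa [← mul_assoc, mul_add, hspa, hsc, zero_add] at this
      rwa [add_mul, h1, add_zero] at hz
    have heq := Submodule.eq_of_le_of_finrank_le hle (hmin _ (Submodule.add_mem _ ha ⟨hcE, hcs⟩))
    have hpk : p ∈ LinearMap.ker (LinearMap.mulLeft K (a + c)) := by
      rw [heq]; simpa using hap
    have hc0 : c = 0 := by
      simpa [add_mul, hap, hcp] using hpk
    simp only [c] at hc0
    rw [mul_add, add_mul, mul_smul_comm, smul_mul_assoc] at hc0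
    rw [hss']
    have := congrArg (fun z => δ • z) hc0
    simp only [smul_add, smul_smul, hδ, one_smul, smul_zero] at this
    exact eq_neg_of_add_eq_zero_right this
  have hp0 : p = 0 := by
    refine field_p_zero hB hD f g hS s hs1 hsm hss hτ hr δ hδ a w p ha hw haw hp hpc hspc ?_
    intro h hh
    by_contra hne
    exact hcase p hpp hpc hspc hpure ⟨h, hh, hne⟩
  refine ⟨a, ha, ?_⟩
  have hwa : w * a = 1 := by rw [hp0] at hp; exact (sub_eq_zero.1 hp.symm).symm
  have : IsArtinianRing D := IsArtinianRing.of_finite K D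
  exact IsUnit.of_mul_eq_one_right _ hwa

end field2
end

open TensorProduct
noncomputable section
section field3
variable {K : Type*} [Field K] {D : Type*} [Ring D] [Algebra K D]
  {B : Type*} [Ring B] [Algebra K B]

/-- part of `f t * E` cut by an idempotent, symmetric of sign `δ` -/
def Wd (f g : B →ₐ[K] D) (s : D →ₗ[K] D) (t : B) (P : D) (δ : K) : Submodule K D :=
  (Ed f g).map (LinearMap.mulLeft K (f t)) ⊓ LinearMap.ker (s - δ • LinearMap.id) ⊓
    LinearMap.ker (LinearMap.mulLeft K (s P) ∘ₗ LinearMap.mulRight K P - LinearMap.id)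

theorem mem_Wd {f g : B →ₐ[K] D} {s : D →ₗ[K] D} {t : B} {P : D} {δ : K} {v : D} :
    v ∈ Wd f g s t P δ ↔ ((∃ h ∈ Ed f g, f t * h = v) ∧ s v = δ • v) ∧ s P * v * P = v := by
  simp only [Wd, Submodule.mem_inf, Submodule.mem_map, LinearMap.mem_ker, LinearMap.sub_apply,
    LinearMap.smul_apply, LinearMap.id_apply, LinearMap.comp_apply, LinearMap.mulLeft_apply,
    LinearMap.mulRight_apply, sub_eq_zero, mul_assoc]

/-- off-diagonal part -/
def Xd (f g : B →ₐ[K] D) (s : D →ₗ[K] D) (t : B) (P P' : D) : Submodule K D :=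
  (Ed f g).map (LinearMap.mulLeft K (f t)) ⊓
    LinearMap.ker (LinearMap.mulLeft K (s P) ∘ₗ LinearMap.mulRight K P' - LinearMap.id)

theorem mem_Xd {f g : B →ₐ[K] D} {s : D →ₗ[K] D} {t : B} {P P' : D} {v : D} :
    v ∈ Xd f g s t P P' ↔ (∃ h ∈ Ed f g, f t * h = v) ∧ s P * v * P' = v := by
  simp only [Xd, Submodule.mem_inf, Submodule.mem_map, LinearMap.mem_ker, LinearMap.sub_apply,
    LinearMap.id_apply, LinearMap.comp_apply, LinearMap.mulLeft_apply,
    LinearMap.mulRight_apply, sub_eq_zero, mul_assoc]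

variable [FiniteDimensional K B] [FiniteDimensional K D]

theorem good_step (f g : B →ₐ[K] D)
    (s : D →ₗ[K] D) (hsm : ∀ a b, s (a * b) = s b * s a) (hss : ∀ a, s (s a) = a)
    (hC : ∀ c, (∀ b, g b * c = c * g b) → ∀ b, f b * s c = s c * f b)
    (hsE : ∀ h ∈ Ed f g, s h ∈ Ed f g) (h2 : (2 : K) ≠ 0)
    (δ : K) (hδ : δ * δ = 1) (P p' : D) (hPP : P * P = P) (hpp : p' * p' = p')
    (hP : ∀ b, g b * P = P * g b) (hp : ∀ b, g b * p' = p' * g b)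
    (h1 : P * p' = 0) (h1' : p' * P = 0)
    (hpure : ∀ h ∈ Ed f g, s (s p' * h * p') = - (δ • (s p' * h * p')))
    (t : B) (ht : t ∈ Subalgebra.center K B) (hst : g t = s (f t))
    (hlt : Module.finrank K (Wd f g s t P δ) < Module.finrank K (Wd f g s t P (-δ))) :
    Module.finrank K (Wd f g s t (P + p') δ) < Module.finrank K (Wd f g s t (P + p') (-δ)) := by
  have ht' : ∀ b, f b * f t = f t * f b := fun b => by
    rw [← map_mul, ← map_mul, Subalgebra.mem_center_iff.1 ht b]
  have hVE : ∀ v, (∃ h ∈ Ed f g, f t * h = v) → v ∈ Ed f g := by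
    rintro _ ⟨h, hh, rfl⟩
    have := Ed_mul (c' := 1) hh ht' (by simp)
    simpa using this
  have hVs : ∀ v, (∃ h ∈ Ed f g, f t * h = v) → (∃ h ∈ Ed f g, f t * h = s v) := by
    rintro _ ⟨h, hh, rfl⟩
    exact ⟨s h, hsE h hh, by rw [hsm, ← hst, hsE h hh t]⟩
  have hVm : ∀ c c' : D, (∀ b, g b * c = c * g b) → (∀ b, g b * c' = c' * g b) →
      ∀ v, (∃ h ∈ Ed f g, f t * h = v) → (∃ h ∈ Ed f g, f t * h = s c * v * c') := by
    rintro c c' hc hc' _ ⟨h, hh, rfl⟩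
    refine ⟨s c * h * c', Ed_mul hh (hC c hc) hc', ?_⟩
    rw [← mul_assoc, ← mul_assoc, ← mul_assoc, hC c hc t]
  have sPP : s P * s P = s P := by rw [← hsm, hPP]
  have spp : s p' * s p' = s p' := by rw [← hsm, hpp]
  have s1 : s p' * s P = 0 := by rw [← hsm, h1, map_zero]
  have s1' : s P * s p' = 0 := by rw [← hsm, h1', map_zero]
  have hPPa : ∀ z, P * (P * z) = P * z := fun z => by rw [← mul_assoc, hPP]
  have sPPa : ∀ z, s P * (s P * z) = s P * z := fun z => by rw [← mul_assoc, sPP]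
  have sppa : ∀ z, s p' * (s p' * z) = s p' * z := fun z => by rw [← mul_assoc, spp]
  have s1a : ∀ z, s p' * (s P * z) = 0 := fun z => by rw [← mul_assoc, s1, zero_mul]
  have s1a' : ∀ z, s P * (s p' * z) = 0 := fun z => by rw [← mul_assoc, s1', zero_mul]
  -- first map
  have A1 : Module.finrank K (Wd f g s t (P + p') δ) ≤
      Module.finrank K (Wd f g s t P δ) + Module.finrank K (Xd f g s t P p') := by
    let F1 : Wd f g s t (P + p') δ →ₗ[K] Wd f g s t P δ :=
      LinearMap.restrict (LinearMap.mulLeft K (s P) ∘ₗ LinearMap.mulRight K P) (by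
        intro v hv
        rw [mem_Wd] at hv ⊢
        simp only [LinearMap.comp_apply, LinearMap.mulLeft_apply, LinearMap.mulRight_apply, ← mul_assoc]
        refine ⟨⟨hVm P P hP hP v hv.1.1, ?_⟩, ?_⟩
        · rw [hsm, hsm, hss, hv.1.2]; simp [mul_assoc]
        · simp only [mul_assoc, hPP, sPPa])
    let F2 : Wd f g s t (P + p') δ →ₗ[K] Xd f g s t P p' :=
      LinearMap.restrict (LinearMap.mulLeft K (s P) ∘ₗ LinearMap.mulRight K p') (by
        intro v hv
        rw [mem_Wd] at hv
        rw [mem_Xd]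
        simp only [LinearMap.comp_apply, LinearMap.mulLeft_apply, LinearMap.mulRight_apply, ← mul_assoc]
        refine ⟨hVm P p' hP hp v hv.1.1, ?_⟩
        simp only [mul_assoc, hpp, sPPa])
    have hinj : Function.Injective (F1.prod F2) := by
      rw [← LinearMap.ker_eq_bot, LinearMap.ker_eq_bot']
      rintro ⟨v, hv⟩ h0
      have e1 : s P * v * P = 0 := by
        have := congrArg (fun z => (z.1 : D)) h0
        simpa [F1, ← mul_assoc] using this
      have e2 : s P * v * p' = 0 := by
        have := congrArg (fun z => (z.2 : D)) h0
        simpa [F2, ← mul_assoc] using this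
      rw [mem_Wd] at hv
      have e3 : s p' * v * P = 0 := by
        have := congrArg s e2
        rw [hsm, hsm, hss, hv.1.2, map_zero] at this
        have h3 := congrArg (fun z => δ • z) this
        simpa [smul_smul, hδ, mul_assoc] using h3
      have e4 : s p' * v * p' = 0 := by
        have a1 := hpure v (hVE v hv.1.1)
        have a2 : s (s p' * v * p') = δ • (s p' * v * p') := by
          rw [hsm, hsm, hss, hv.1.2]; simp [mul_assoc]
        rw [a2] at a1
        have a3 := congrArg (fun z => δ • z) a1
        simp only [smul_smul, smul_neg, hδ, one_smul] at a3
        have a4 : (2 : K) • (s p' * v * p') = 0 := by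
          rw [two_smul]; nth_rewrite 1 [a3]; simp
        exact (smul_eq_zero.1 a4).resolve_left h2
      have : v = 0 := by
        rw [← hv.2, map_add]
        simp only [add_mul, mul_add, e1, e2, e3, e4, add_zero]
      exact Subtype.ext this
    have := LinearMap.finrank_le_finrank_of_injective hinj
    rwa [Module.finrank_prod] at this
  have A2 : Module.finrank K (Wd f g s t P (-δ)) + Module.finrank K (Xd f g s t P p') ≤
      Module.finrank K (Wd f g s t (P + p') (-δ)) := by
    let G0 : (Wd f g s t P (-δ) × Xd f g s t P p') →ₗ[K] D :=
      ((Wd f g s t P (-δ)).subtype).coprod ((LinearMap.id - δ • s) ∘ₗ (Xd f g s t P p').subtype)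
    have hG0 : ∀ q, G0 q = (q.1 : D) + ((q.2 : D) - δ • s (q.2 : D)) := by
      intro q; simp [G0]
    have hzs : ∀ z, s P * z * p' = z → s p' * s z * P = s z := by
      intro z hz
      conv_rhs => rw [← hz]
      rw [hsm, hsm, hss, mul_assoc]
    let G : (Wd f g s t P (-δ) × Xd f g s t P p') →ₗ[K] Wd f g s t (P + p') (-δ) :=
      LinearMap.codRestrict _ G0 (by
        rintro ⟨⟨v, hv⟩, ⟨z, hz⟩⟩
        rw [hG0, mem_Wd]
        rw [mem_Wd] at hv
        rw [mem_Xd] at hz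
        refine ⟨⟨?_, ?_⟩, ?_⟩
        · obtain ⟨⟨⟨h, hh, rfl⟩, -⟩, -⟩ := hv
          obtain ⟨h', hh', e'⟩ := hz.1
          obtain ⟨h'', hh'', e''⟩ := hVs z hz.1
          refine ⟨h + (h' - δ • h''), Submodule.add_mem _ hh (Submodule.sub_mem _ hh' (Submodule.smul_mem _ _ hh'')), ?_⟩
          simp only
          rw [mul_add, mul_sub, e', mul_smul_comm, e'']
        · simp only [map_add, map_sub, map_smul, hv.1.2, hss, smul_add, smul_sub, smul_smul, neg_mul, hδ,
            neg_smul, one_smul]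
          abel
        · have b1 : s (P + p') * v * (P + p') = v := by
            rw [← hv.2, map_add]
            simp only [add_mul, mul_add, mul_assoc, hPP, sPPa, h1, s1a, mul_zero, add_zero, zero_add]
          have b2 : s (P + p') * z * (P + p') = z := by
            rw [← hz.2, map_add]
            simp only [add_mul, mul_add, mul_assoc, hpp, sPPa, h1', s1a, mul_zero, add_zero, zero_add]
          have b3 : s (P + p') * s z * (P + p') = s z := by
            rw [← hzs z hz.2, map_add]
            simp only [add_mul, mul_add, mul_assoc, hPP, sppa, h1, s1a', mul_zero, add_zero, zero_add]
          simp only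
          rw [mul_add (s (P + p')) v, mul_sub, mul_smul_comm, add_mul, sub_mul, smul_mul_assoc, b1, b2, b3])
    have hinj : Function.Injective G := by
      rw [← LinearMap.ker_eq_bot, LinearMap.ker_eq_bot']
      rintro ⟨⟨v, hv⟩, ⟨z, hz⟩⟩ h0
      have e0 : v + (z - δ • s z) = 0 := by
        have := congrArg Subtype.val h0
        simpa [G, hG0] using this
      rw [mem_Wd] at hv
      rw [mem_Xd] at hz
      have hv1 : s P * v * p' = 0 := by rw [← hv.2]; simp only [mul_assoc, h1, mul_zero]
      have hz1 : s P * z * P = 0 := by rw [← hz.2]; simp only [mul_assoc, h1', mul_zero]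
      have hz2 : s P * s z = 0 := by rw [← hzs z hz.2]; simp only [mul_assoc, s1a']
      have c1 := congrArg (fun d => s P * d * P) e0
      simp only [mul_add, mul_sub, add_mul, sub_mul, mul_smul_comm, hz2, hz1, hv.2, smul_zero, zero_mul,
        mul_zero, sub_zero, add_zero] at c1
      have c2 := congrArg (fun d => s P * d * p') e0
      simp only [mul_add, mul_sub, add_mul, sub_mul, mul_smul_comm, hz2, hv1, hz.2, smul_zero, zero_mul,
        mul_zero, sub_zero, zero_add] at c2
      subst c1
      subst c2
      rfl
    have := LinearMap.finrank_le_finrank_of_injective hinj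
    rwa [Module.finrank_prod] at this
  omega

theorem field_caseV {n n' : ℕ} {x y : Fin n → B} (hB : SepFam K x y) {a' c' : Fin n' → D}
    (hD : SepFam K a' c') (f g : B →ₐ[K] D)
    (hS : ∀ s ∈ Subalgebra.center K D, ∃ t ∈ Subalgebra.center K B, f t = s ∧ g t = s)
    (s : D →ₗ[K] D) (hs1 : s 1 = 1) (hsm : ∀ a b, s (a * b) = s b * s a) (hss : ∀ a, s (s a) = a)
    (hτ : ∀ b, ∃ b', g b' = s (f b) ∧ f b' = s (g b))
    (hr : ∀ t ∈ Subalgebra.center K B, Module.finrank K (LinearMap.range (LinearMap.mulLeft K (f t)))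
      = Module.finrank K (LinearMap.range (LinearMap.mulLeft K (g t))))
    (h2 : (2 : K) ≠ 0)
    (δ : K) (hδ : δ * δ = 1) (hst : ∀ t ∈ Subalgebra.center K B, g t = s (f t))
    (hrank : ∀ t ∈ Subalgebra.center K B,
      Module.finrank K ((Ee f g s (-δ)).map (LinearMap.mulLeft K (f t))) ≤
      Module.finrank K ((Ee f g s δ).map (LinearMap.mulLeft K (f t)))) :
    ∃ a ∈ Ee f g s δ, IsUnit a := by
  classical
  refine field_caseA hB hD f g hS s hs1 hsm hss hτ hr δ hδ ?_
  rintro p hpp hpc hspc hpure ⟨h, hh, hne⟩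
  have hC : ∀ c, (∀ b, g b * c = c * g b) → ∀ b, f b * s c = s c * f b := by
    intro c hc b
    obtain ⟨b', h1, h2⟩ := hτ b
    have := congrArg s (hc b')
    rw [hsm, hsm, h1, hss] at this
    exact this.symm
  have hsE : ∀ h ∈ Ed f g, s h ∈ Ed f g := by
    intro h hh b
    obtain ⟨b', h1, h2⟩ := hτ b
    have := congrArg s (hh b')
    rw [hsm, hsm, h1, h2, hss, hss] at this
    exact this.symm
  have dup : ∀ v : D, δ • v = -(δ • v) → v = 0 := by
    intro v a1
    have a3 := congrArg (fun z => δ • z) a1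
    simp only [smul_smul, smul_neg, hδ, one_smul] at a3
    have a4 : (2 : K) • v = 0 := by
      rw [two_smul]; nth_rewrite 1 [a3]; simp
    exact (smul_eq_zero.1 a4).resolve_left h2
  let good : Set D := {P | P * P = P ∧ (∀ b, g b * P = P * g b) ∧ ∀ t ∈ Subalgebra.center K B,
    g t * p = p → Module.finrank K (Wd f g s t P δ) < Module.finrank K (Wd f g s t P (-δ))}
  have hpg : p ∈ good := by
    refine ⟨hpp, hpc, fun t ht htp => ?_⟩
    have ht' : ∀ b, f b * f t = f t * f b := fun b => by
      rw [← map_mul, ← map_mul, Subalgebra.mem_center_iff.1 ht b]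
    have e1 : Wd f g s t p δ = ⊥ := by
      rw [eq_bot_iff]
      intro v hv
      rw [mem_Wd] at hv
      obtain ⟨⟨⟨k, hk, rfl⟩, h3⟩, h4⟩ := hv
      have hE : f t * k ∈ Ed f g := by
        simpa using Ed_mul (c' := 1) hk ht' (by simp)
      have := hpure _ hE
      rw [h4, h3] at this
      exact dup _ this
    have e2 : s p * h * p ∈ Wd f g s t p (-δ) := by
      rw [mem_Wd]
      have hE := Ed_mul hh hspc hpc
      refine ⟨⟨⟨_, hE, ?_⟩, ?_⟩, ?_⟩
      · rw [hE t, mul_assoc, ← hpc, htp]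
      · rw [hpure h hh, neg_smul]
      · have : s p * s p = s p := by rw [← hsm, hpp]
        simp only [mul_assoc, hpp]
        rw [← mul_assoc (s p), this]
    rw [e1, finrank_bot]
    rw [Module.finrank_pos_iff]
    exact ⟨⟨⟨_, e2⟩, 0, fun h => hne (congrArg Subtype.val h)⟩⟩
  obtain ⟨P, ⟨hPP, hPc, hPg⟩, hmax⟩ := (measure (fun P : D => Module.finrank K D -
      Module.finrank K (LinearMap.range (LinearMap.mulLeft K P)))).wf.has_min good ⟨p, hpg⟩
  by_cases hx : ∀ c, (∀ b, g b * c = c * g b) → p * c * (1 - P) = 0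
  · obtain ⟨t, ht, ht1, ht2⟩ := lemmaH hB hD g g (fun z hz => by
      obtain ⟨t, h1, h2, h3⟩ := hS z hz
      exact ⟨t, h1, h3, h3⟩) p (1 - P) hpc (fun b => by rw [mul_sub, sub_mul, hPc, one_mul, mul_one]) hx
    obtain ⟨t', ht'⟩ : ∃ t', t' = 1 - t := ⟨_, rfl⟩
    have htc' : t' ∈ Subalgebra.center K B := by
      rw [ht']; exact Subalgebra.sub_mem _ (Subalgebra.one_mem _) ht
    have hgt' : g t' = g t' * P := by
      have : g t' * (1 - P) = 0 := by rw [ht', map_sub, map_one, sub_mul, ht2, one_mul, sub_self]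
      rw [mul_sub, mul_one] at this
      exact sub_eq_zero.1 this
    have hlt := hPg t' htc' (by rw [ht', map_sub, map_one, sub_mul, ht1, one_mul, sub_zero])
    have hsft : ∀ k ∈ Ed f g, s (f t' * k) = f t' * s k := by
      intro k hk
      rw [hsm, ← hst t' htc', hsE k hk]
    have htf : ∀ b, f b * f t' = f t' * f b := fun b => by
      rw [← map_mul, ← map_mul, Subalgebra.mem_center_iff.1 htc' b]
    have i1 : (Ee f g s δ).map (LinearMap.mulLeft K (f t')) ≤ Wd f g s t' P δ := by
      rintro _ ⟨k, hk, rfl⟩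
      rw [mem_Wd]
      have hvP : ∀ k ∈ Ed f g, f t' * k * P = f t' * k := by
        intro k hk
        rw [hk t', mul_assoc, ← hgt']
      have hsv : s (f t' * k) = δ • (f t' * k) := by rw [hsft k hk.1, hk.2, mul_smul_comm]
      simp only [LinearMap.mulLeft_apply]
      refine ⟨⟨⟨k, hk.1, rfl⟩, hsv⟩, ?_⟩
      rw [mul_assoc, hvP k hk.1]
      have := congrArg s (hvP k hk.1)
      rw [hsm, hsv, mul_smul_comm] at this
      have h3 := congrArg (fun z => δ • z) this
      simpa [smul_smul, hδ] using h3
    have i2 : Wd f g s t' P (-δ) ≤ (Ee f g s (-δ)).map (LinearMap.mulLeft K (f t')) := by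
      intro v hv
      rw [mem_Wd] at hv
      obtain ⟨⟨⟨k, hk, rfl⟩, h3⟩, h4⟩ := hv
      refine ⟨(2 : K)⁻¹ • (k + (-δ) • s k), ⟨Submodule.smul_mem _ _ (Submodule.add_mem _ hk
        (Submodule.smul_mem _ _ (hsE k hk))), ?_⟩, ?_⟩
      · simp only [map_smul, map_add, hss, smul_add, smul_smul]
        rw [add_comm]
        congr 2 <;> first | ring1 | linear_combination (-2⁻¹ : K) * hδ | linear_combination (2⁻¹ : K) * hδ
      · simp only [LinearMap.mulLeft_apply, mul_smul_comm, mul_add]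
        rw [← hsft k hk, h3, smul_smul, neg_mul_neg, hδ, one_smul, ← two_smul K, smul_smul,
          inv_mul_cancel₀ h2, one_smul]
    have j1 := Submodule.finrank_mono i1
    have j2 := Submodule.finrank_mono i2
    have j3 := hrank t' htc'
    omega
  · push Not at hx
    obtain ⟨c, hc, hcx⟩ := hx
    obtain ⟨x, hxd⟩ : ∃ x, x = p * c * (1 - P) := ⟨_, rfl⟩
    rw [← hxd] at hcx
    have hQ : (1 - P) * (1 - P) = 1 - P := by rw [mul_sub, sub_mul, sub_mul, hPP]; simp
    have hQc : ∀ b, g b * (1 - P) = (1 - P) * g b := fun b => by rw [mul_sub, sub_mul, hPc, one_mul, mul_one]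
    have mulc : ∀ u v : D, (∀ b, g b * u = u * g b) → (∀ b, g b * v = v * g b) →
        ∀ b, g b * (u * v) = u * v * g b := by
      intro u v hu hv b
      rw [← mul_assoc, hu, mul_assoc, hv, mul_assoc]
    have hxc : ∀ b, g b * x = x * g b := by
      rw [hxd]; exact mulc _ _ (mulc _ _ hpc hc) hQc
    have hpx : p * x = x := by rw [hxd, ← mul_assoc, ← mul_assoc, hpp]
    have hxQ : x * (1 - P) = x := by rw [hxd, mul_assoc, hQ]
    obtain ⟨y0, hy0, hxy0⟩ := lemmaM hB hD g g x hxc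
    obtain ⟨y', hy'⟩ : ∃ y', y' = (1 - P) * y0 * p := ⟨_, rfl⟩
    have hyc : ∀ b, g b * y' = y' * g b := by
      rw [hy']; exact mulc _ _ (mulc _ _ hQc hy0) hpc
    have hxy : x * y' * x = x := by
      rw [hy', ← mul_assoc, ← mul_assoc, hxQ, mul_assoc _ p, hpx, hxy0]
    have hyp : y' * p = y' := by rw [hy', mul_assoc, hpp]
    have hQy : (1 - P) * y' = y' := by rw [hy', ← mul_assoc, ← mul_assoc, hQ]
    have hPy : P * y' = 0 := by
      rw [sub_mul, one_mul] at hQy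
      simpa using hQy
    have hxP : x * P = 0 := by
      rw [mul_sub, mul_one] at hxQ
      simpa using hxQ
    obtain ⟨p', hp'⟩ : ∃ p', p' = y' * x := ⟨_, rfl⟩
    have hpp' : p' * p' = p' := by rw [hp', mul_assoc, ← mul_assoc x, hxy]
    have hp0 : p' ≠ 0 := by
      intro h0
      apply hcx
      rw [← hxy, mul_assoc, ← hp', h0, mul_zero]
    have hp'c : ∀ b, g b * p' = p' * g b := by rw [hp']; exact mulc _ _ hyc hxc
    have o1 : P * p' = 0 := by rw [hp', ← mul_assoc, hPy, zero_mul]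
    have o2 : p' * P = 0 := by rw [hp', mul_assoc, hxP, mul_zero]
    have hpure' : ∀ h ∈ Ed f g, s (s p' * h * p') = - (δ • (s p' * h * p')) := by
      intro h hh
      have hk := hpure (s y' * h * y') (Ed_mul hh (hC y' hyc) hyc)
      have hk1 : s p * (s y' * h * y') * p = s y' * h * y' := by
        rw [mul_assoc, mul_assoc _ y', hyp, ← mul_assoc, ← mul_assoc, ← hsm, hyp]
      rw [hk1] at hk
      have e : s p' * h * p' = s x * (s y' * h * y') * x := by
        rw [hp', hsm]; simp only [mul_assoc]
      rw [e, hsm, hsm, hk, hss]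
      simp [mul_assoc]
    refine hmax (P + p') ⟨?_, ?_, ?_⟩ ?_
    · rw [add_mul, mul_add, mul_add, hPP, o1, o2, hpp']; simp
    · intro b; rw [mul_add, add_mul, hPc, hp'c]
    · intro t ht htp
      exact good_step f g s hsm hss hC hsE h2 δ hδ P p' hPP hpp' hPc hp'c o1 o2 hpure' t ht (hst t ht)
        (hPg t ht htp)
    · have hlt : LinearMap.range (LinearMap.mulLeft K P) < LinearMap.range (LinearMap.mulLeft K (P + p')) := by
        refine lt_of_le_of_ne ?_ fun heq => hp0 ?_
        · rintro _ ⟨z, rfl⟩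
          refine ⟨P * z, ?_⟩
          simp only [LinearMap.mulLeft_apply]
          rw [← mul_assoc, add_mul, hPP, o2, add_zero]
        · have : p' ∈ LinearMap.range (LinearMap.mulLeft K (P + p')) :=
            ⟨p', by simp only [LinearMap.mulLeft_apply]; rw [add_mul, o1, hpp', zero_add]⟩
          rw [← heq] at this
          obtain ⟨z, hz⟩ := this
          simp only [LinearMap.mulLeft_apply] at hz
          rw [← o1]
          conv_rhs => rw [← hz]
          rw [← mul_assoc, hPP, hz]
      have k1 := Submodule.finrank_lt_finrank_of_lt hlt
      have k2 := Submodule.finrank_le (LinearMap.range (LinearMap.mulLeft K (P + p')))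
      show Module.finrank K D - _ < Module.finrank K D - _
      omega

theorem field_caseIV {n n' : ℕ} {x y : Fin n → B} (hB : SepFam K x y) {a' c' : Fin n' → D}
    (hD : SepFam K a' c') (f g : B →ₐ[K] D)
    (hS : ∀ s ∈ Subalgebra.center K D, ∃ t ∈ Subalgebra.center K B, f t = s ∧ g t = s)
    (s : D →ₗ[K] D) (hs1 : s 1 = 1) (hsm : ∀ a b, s (a * b) = s b * s a) (hss : ∀ a, s (s a) = a)
    (τ : B → B) (hτ1 : ∀ b, g (τ b) = s (f b)) (hτ2 : ∀ b, f (τ b) = s (g b))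
    (hr : ∀ t ∈ Subalgebra.center K B, Module.finrank K (LinearMap.range (LinearMap.mulLeft K (f t)))
      = Module.finrank K (LinearMap.range (LinearMap.mulLeft K (g t))))
    (δ : K) (hδ : δ * δ = 1) {m : ℕ} (u v : Fin m → B) (hv : ∀ i, v i ∈ Subalgebra.center K B)
    (huv : ∑ i, u i * (v i - τ (v i)) = 1) :
    ∃ a ∈ Ee f g s δ, IsUnit a := by
  refine field_caseA hB hD f g hS s hs1 hsm hss (fun b => ⟨τ b, hτ1 b, hτ2 b⟩) hr δ hδ ?_
  rintro p hpp hpc hspc hpure ⟨h, hh, hne⟩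
  apply hne
  have key : ∀ t ∈ Subalgebra.center K B, f (t - τ t) * (s p * h * p) = 0 := by
    intro t ht
    have ht' : ∀ b, f b * f t = f t * f b := fun b => by
      rw [← map_mul, ← map_mul, Subalgebra.mem_center_iff.1 ht b]
    have hE := Ed_mul hh hspc hpc
    have e1 : f t * (s p * h * p) = s p * (f t * h) * p := by
      rw [← mul_assoc, ← mul_assoc, hspc]; simp only [mul_assoc]
    have hth : f t * h ∈ Ed f g := by simpa using Ed_mul (c' := 1) hh ht' (by simp)
    have e2 := hpure _ hth
    rw [← e1, hsm, hpure h hh, ← hτ1, neg_mul, smul_mul_assoc, ← hE] at e2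
    have e3 := congrArg (fun z => -(δ • z)) e2
    simp only [smul_neg, neg_neg, smul_smul, hδ, one_smul] at e3
    rw [map_sub, sub_mul, e3, sub_self]
  calc s p * h * p = f (∑ i, u i * (v i - τ (v i))) * (s p * h * p) := by rw [huv, map_one, one_mul]
    _ = 0 := by
      rw [map_sum, Finset.sum_mul]
      refine Finset.sum_eq_zero fun i _ => ?_
      rw [map_mul, mul_assoc, key _ (hv i), mul_zero]
end field3
end

open TensorProduct
noncomputable section
section sep
variable {R : Type*} [CommRing R] {B : Type*} [Ring B] [Algebra R B]
  {T : Type*} [CommRing T] [Algebra R T] [Algebra T B] [IsScalarTower R T B]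

theorem exists_pi (hinj : Function.Injective (algebraMap T B))
    (hcen : ∀ b : B, (∀ c, c * b = b * c) → ∃ t : T, algebraMap T B t = b)
    {n : ℕ} {x y : Fin n → B} (h : SepFam R x y) :
    ∃ π : B →ₗ[T] T, π 1 = 1 ∧ ∀ b, algebraMap T B (π b) = ∑ i, x i * b * y i := by
  choose π hπ using fun b => hcen (∑ i, x i * b * y i) (fun c => h.central b c)
  refine ⟨⟨⟨π, fun a b => hinj ?_⟩, fun t b => hinj ?_⟩, hinj ?_, hπ⟩
  · rw [map_add, hπ, hπ, hπ, ← Finset.sum_add_distrib]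
    simp only [mul_add, add_mul]
  · simp only [RingHom.id_apply, smul_eq_mul, map_mul, hπ, Finset.mul_sum]
    refine Finset.sum_congr rfl fun i _ => ?_
    rw [Algebra.smul_def, ← mul_assoc (x i), ← Algebra.commutes t (x i)]
    simp only [mul_assoc]
  · show algebraMap T B (π 1) = _
    rw [hπ, map_one]
    simpa using h.1

theorem sepCenter [Module.Finite R B] (hinj : Function.Injective (algebraMap T B))
    (hcen : ∀ b : B, (∀ c, c * b = b * c) → ∃ t : T, algebraMap T B t = b)
    {n : ℕ} {x y : Fin n → B} (h : SepFam R x y) :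
    ∃ t : T ⊗[R] T, (∀ s, ((1 : T) ⊗ₜ[R] s - s ⊗ₜ[R] (1 : T)) * t = 0) ∧
      Algebra.TensorProduct.lmul' R t = 1 := by
  classical
  obtain ⟨π, hπ1, hπ⟩ := exists_pi hinj hcen h
  let J : Ideal (T ⊗[R] T) :=
    { carrier := {z | ∀ s, ((1 : T) ⊗ₜ[R] s - s ⊗ₜ[R] (1 : T)) * z = 0}
      add_mem' := fun {a b} ha hb s => by rw [mul_add, ha, hb, add_zero]
      zero_mem' := fun s => by simp
      smul_mem' := fun c z hz s => by rw [smul_eq_mul, mul_left_comm, hz, mul_zero] }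
  let μ : T ⊗[R] T →ₐ[R] T := Algebra.TensorProduct.lmul' R
  have hμ : Function.Surjective μ := fun t => ⟨t ⊗ₜ 1, by simp [μ]⟩
  suffices h1 : J.map μ = ⊤ by
    have : (1 : T) ∈ J.map μ := by rw [h1]; trivial
    rw [Ideal.mem_map_iff_of_surjective μ hμ] at this
    obtain ⟨z, hz, hz1⟩ := this
    exact ⟨z, hz, hz1⟩
  by_contra hne
  obtain ⟨m, hm, hle⟩ := Ideal.exists_le_maximal _ hne
  have key : ∀ u v u' v' : B, ∑ i, π (u * x i * v) * π (u' * y i * v') ∈ m := by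
    intro u v u' v'
    have hz : (∑ i, π (u * x i * v) ⊗ₜ[R] π (u' * y i * v')) ∈ J := by
      intro s
      have e := h.bil ((TensorProduct.mk R T T).compl₁₂
        ((π.restrictScalars R) ∘ₗ LinearMap.mulRight R v ∘ₗ LinearMap.mulLeft R u)
        ((π.restrictScalars R) ∘ₗ LinearMap.mulRight R v' ∘ₗ LinearMap.mulLeft R u'))
        (algebraMap T B s)
      simp only [LinearMap.compl₁₂_apply, LinearMap.comp_apply, LinearMap.mulLeft_apply,
        LinearMap.mulRight_apply, TensorProduct.mk_apply, LinearMap.restrictScalars_apply] at e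
      rw [sub_mul, sub_eq_zero, Finset.mul_sum, Finset.mul_sum]
      simp only [Algebra.TensorProduct.tmul_mul_tmul, one_mul]
      have e1 : ∀ i, s * π (u * x i * v) = π (u * (algebraMap T B s * x i) * v) := by
        intro i
        rw [← smul_eq_mul, ← map_smul, Algebra.smul_def]
        congr 1
        rw [← mul_assoc u, ← Algebra.commutes s u]; simp only [mul_assoc]
      have e2 : ∀ i, s * π (u' * y i * v') = π (u' * (y i * algebraMap T B s) * v') := by
        intro i
        rw [← smul_eq_mul, ← map_smul, Algebra.smul_def]
        congr 1
        rw [← Algebra.commutes s (y i), ← mul_assoc u', ← Algebra.commutes s u']; simp only [mul_assoc]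
      simp only [e1, e2]
      exact e.symm
    have := hle (Ideal.mem_map_of_mem μ hz)
    simpa [μ] using this
  let N : Submodule T B :=
    { carrier := {b | ∀ u v, π (u * b * v) ∈ m}
      add_mem' := fun {a b} ha hb u v => by
        rw [mul_add, add_mul, map_add]; exact m.add_mem (ha u v) (hb u v)
      zero_mem' := fun u v => by simp
      smul_mem' := fun c b hb u v => by
        rw [mul_smul_comm, smul_mul_assoc, map_smul]
        exact m.mul_mem_left _ (hb u v) }
  have hN : ∀ b, b ∈ N ↔ ∀ u v, π (u * b * v) ∈ m := fun b => Iff.rfl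
  have hNl : ∀ b c, b ∈ N → c * b ∈ N := fun b c hb u v => by
    have := hb (u * c) v; rwa [mul_assoc u c b] at this
  have hNr : ∀ b c, b ∈ N → b * c ∈ N := fun b c hb u v => by
    have := hb u (c * v)
    simpa only [mul_assoc] using this
  have h1N : (1 : B) ∉ N := by
    intro h1
    have := h1 1 1
    simp only [mul_one, hπ1] at this
    exact hm.ne_top ((Ideal.eq_top_iff_one _).2 this)
  have hw : ∀ u' v', ∑ i, π (u' * y i * v') • x i ∈ N := by
    intro u' v' u v
    rw [Finset.mul_sum, Finset.sum_mul, map_sum]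
    have := key u v u' v'
    convert this using 2 with i
    rw [mul_smul_comm, smul_mul_assoc, map_smul, smul_eq_mul, mul_comm]
  have hmN : Module.IsTorsionBySet T (B ⧸ N) m := by
    rw [Module.isTorsionBySet_quotient_iff]
    intro b r hr u v
    rw [mul_smul_comm, smul_mul_assoc, map_smul]
    exact m.mul_mem_right _ hr
  letI := Ideal.Quotient.field m
  letI : Module (T ⧸ m) (B ⧸ N) := hmN.module
  haveI : IsScalarTower T (T ⧸ m) (B ⧸ N) := hmN.isScalarTower
  haveI : Module.Finite T B := Module.Finite.of_restrictScalars_finite R T B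
  haveI : Module.Finite T (B ⧸ N) := inferInstance
  haveI : Module.Finite (T ⧸ m) (B ⧸ N) := Module.Finite.of_restrictScalars_finite T (T ⧸ m) (B ⧸ N)
  let b := Module.finBasis (T ⧸ m) (B ⧸ N)
  choose l hl using fun j => N.mkQ_surjective (b j)
  choose c hc using fun (i : Fin n) j => Ideal.Quotient.mk_surjective (I := m) (b.coord j (N.mkQ (x i)))
  have hsm : ∀ (t : T) (q : B ⧸ N), (Ideal.Quotient.mk m t) • q = t • q := fun t q => rfl
  have hx : ∀ i, x i - ∑ j, c i j • l j ∈ N := by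
    intro i
    rw [← (Submodule.Quotient.mk_eq_zero N), ← Submodule.mkQ_apply, map_sub, map_sum]
    simp only [map_smul, hl, ← hsm, hc]
    simp only [Module.Basis.coord_apply, Module.Basis.sum_repr, sub_self]
  have hy : ∀ j, ∑ i, c i j • y i ∈ N := by
    intro j u v
    rw [Finset.mul_sum, Finset.sum_mul, map_sum, ← Ideal.Quotient.eq_zero_iff_mem, map_sum]
    have h0 := congrArg (b.coord j) ((Submodule.Quotient.mk_eq_zero N).2 (hw u v))
    rw [map_zero, ← Submodule.mkQ_apply, map_sum, map_sum] at h0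
    rw [← h0]
    refine Finset.sum_congr rfl fun i _ => ?_
    rw [map_smul, ← hsm, map_smul, mul_smul_comm, smul_mul_assoc, map_smul, smul_eq_mul, smul_eq_mul,
      map_mul, hc, mul_comm]
  apply h1N
  have : (1 : B) = ∑ i, (x i - ∑ j, c i j • l j) * y i + ∑ j, l j * ∑ i, c i j • y i := by
    have e : ∑ j, l j * ∑ i, c i j • y i = ∑ i, (∑ j, c i j • l j) * y i := by
      simp only [Finset.mul_sum, Finset.sum_mul, mul_smul_comm, smul_mul_assoc]
      exact Finset.sum_comm
    rw [e, ← Finset.sum_add_distrib, ← h.1]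
    refine Finset.sum_congr rfl fun i _ => ?_
    rw [← add_mul, sub_add_cancel]
  rw [this]
  exact N.add_mem (N.sum_mem fun i _ => hNr _ _ (hx i)) (N.sum_mem fun j _ => hNl _ _ (hy j))

theorem center_unramified [Module.Finite R B] (hinj : Function.Injective (algebraMap T B))
    (hcen : ∀ b : B, (∀ c, c * b = b * c) → ∃ t : T, algebraMap T B t = b)
    {n : ℕ} {x y : Fin n → B} (h : SepFam R x y) :
    Module.Finite R T ∧ Algebra.FormallyUnramified R T := by
  obtain ⟨π, hπ1, hπ⟩ := exists_pi hinj hcen h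
  have : Module.Finite R T := Module.Finite.of_surjective (π.restrictScalars R) (fun t => ⟨algebraMap T B t, by
    rw [LinearMap.restrictScalars_apply, Algebra.algebraMap_eq_smul_one, map_smul, hπ1, smul_eq_mul, mul_one]⟩)
  exact ⟨this, Algebra.FormallyUnramified.iff_exists_tensorProduct.2 (sepCenter hinj hcen h)⟩
end sep

section semi
variable {R : Type*} [CommRing R] {T : Type*} [CommRing T] [Algebra R T]

theorem semilocal_finite (R T : Type*) [CommRing R] [CommRing T] [Algebra R T]
    [Finite (MaximalSpectrum R)] [Module.Finite R T] : Finite (MaximalSpectrum T) := by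
  have h1 : (⋃ m : MaximalSpectrum R, Ideal.primesOver m.1 T).Finite :=
    Set.finite_iUnion fun m => Algebra.QuasiFinite.finite_primesOver m.1
  have : Finite ↥(⋃ m : MaximalSpectrum R, Ideal.primesOver m.1 T) := h1
  refine Finite.of_injective (fun n : MaximalSpectrum T =>
    (⟨n.1, ?_⟩ : ↥(⋃ m : MaximalSpectrum R, Ideal.primesOver m.1 T))) ?_
  · have := n.2
    have hm : (n.1.comap (algebraMap R T)).IsMaximal := Ideal.isMaximal_comap_of_isIntegral_of_isMaximal n.1
    exact Set.mem_iUnion.2 ⟨⟨_, hm⟩, n.2.isPrime, ⟨rfl⟩⟩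
  · intro a b h
    exact MaximalSpectrum.ext (congrArg (fun z => z.1) h)

theorem free_of_conn (T : Type*) [CommRing T] [Finite (MaximalSpectrum T)]
    (hc : ∀ e : T, IsIdempotentElem e → e = 0 ∨ e = 1)
    (M : Type*) [AddCommGroup M] [Module T M] [Module.Finite T M] [Module.Projective T M] : Module.Free T M := by
  have : Module.FinitePresentation T M := Module.finitePresentation_of_projective T M
  have hloc := Module.isLocallyConstant_rankAtStalk (R := T) (M := M)
  have : PreconnectedSpace (PrimeSpectrum T) := by
    rw [preconnectedSpace_iff_clopen]
    intro s hs
    obtain ⟨e, he, rfl⟩ := (PrimeSpectrum.isClopen_iff).1 hs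
    rcases hc e he with rfl | rfl
    · left; simp
    · right; simp
  rcases isEmpty_or_nonempty (PrimeSpectrum T) with hE | ⟨⟨p0⟩⟩
  · refine Module.free_of_flat_of_finrank_eq T M 0 fun P => (hE.false (P.toPrimeSpectrum)).elim
  refine Module.free_of_flat_of_finrank_eq T M (Module.rankAtStalk M p0) fun P => ?_
  rw [hloc.apply_eq_of_preconnectedSpace p0 P.toPrimeSpectrum]
  have := P.2
  letI := Ideal.Quotient.field P.1
  let q : PrimeSpectrum (T ⧸ P.1) := ⟨⊥, Ideal.isPrime_bot⟩
  have hq : P.toPrimeSpectrum = PrimeSpectrum.comap (algebraMap T (T ⧸ P.1)) q := by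
    ext1
    simp [q, MaximalSpectrum.toPrimeSpectrum, ← RingHom.ker_eq_comap_bot]
  rw [hq, ← Module.rankAtStalk_baseChange, Module.rankAtStalk_eq_finrank_of_free]
  rfl

/-- modules over an unramified connected semilocal algebra are determined by the base module -/
theorem equiv_of_equiv.{u} (R T : Type*) [CommRing R] [CommRing T] [Algebra R T] [Module.Finite R T]
    [Algebra.FormallyUnramified R T] [Finite (MaximalSpectrum R)] [Nontrivial T]
    (hc : ∀ e : T, IsIdempotentElem e → e = 0 ∨ e = 1)
    (M M' : Type u) [AddCommGroup M] [Module T M] [Module R M] [IsScalarTower R T M]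
    [AddCommGroup M'] [Module T M'] [Module R M'] [IsScalarTower R T M']
    [Module.Finite R M] [Module.Projective R M] [Module.Projective R M']
    (e : M ≃ₗ[R] M') : Nonempty (M ≃ₗ[T] M') := by
  have : Module.Finite R M' := Module.Finite.equiv e
  have := semilocal_finite R T
  have : Module.Finite T M := Module.Finite.of_restrictScalars_finite R T M
  have : Module.Finite T M' := Module.Finite.of_restrictScalars_finite R T M'
  have : Module.Projective T M := Algebra.FormallyUnramified.projective_of_restrictScalars R T M
  have : Module.Projective T M' := Algebra.FormallyUnramified.projective_of_restrictScalars R T M'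
  have := free_of_conn T hc M
  have := free_of_conn T hc M'
  refine FiniteDimensional.nonempty_linearEquiv_of_finrank_eq ?_
  obtain ⟨n, hn⟩ := Ideal.exists_maximal T
  let m : Ideal R := n.comap (algebraMap R T)
  have hm : m.IsMaximal := Ideal.isMaximal_comap_of_isIntegral_of_isMaximal n
  letI := Ideal.Quotient.field m
  let ψ : (R ⧸ m) →ₐ[R] (T ⧸ n) := Ideal.Quotient.liftₐ m (Algebra.ofId R (T ⧸ n)) (fun a ha => by
    rw [Algebra.ofId_apply, IsScalarTower.algebraMap_apply R T (T ⧸ n)]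
    exact Ideal.Quotient.eq_zero_iff_mem.2 ha)
  let Ψ : (R ⧸ m) ⊗[R] T →ₐ[R] (T ⧸ n) :=
    Algebra.TensorProduct.lift ψ (Ideal.Quotient.mkₐ R n) (fun _ _ => Commute.all _ _)
  have hnt : Nontrivial ((R ⧸ m) ⊗[R] T) := RingHom.domain_nontrivial Ψ.toRingHom
  have key : ∀ (M : Type u) [AddCommGroup M] [Module T M] [Module R M] [IsScalarTower R T M]
      [Module.Finite T M] [Module.Free T M], Module.finrank (R ⧸ m) ((R ⧸ m) ⊗[R] M) =
      Module.finrank T M * Module.finrank (R ⧸ m) ((R ⧸ m) ⊗[R] T) := by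
    intro M _ _ _ _ _ _
    let e1 : M ≃ₗ[R] (Fin (Module.finrank T M) → T) :=
      ((Module.finBasis T M).equivFun).restrictScalars R
    let e2 : ((R ⧸ m) ⊗[R] M) ≃ₗ[R ⧸ m] (Fin (Module.finrank T M) → ((R ⧸ m) ⊗[R] T)) :=
      (e1.baseChange R (R ⧸ m) _ _) ≪≫ₗ TensorProduct.piRight R (R ⧸ m) (R ⧸ m) (fun _ => T)
    rw [e2.finrank_eq, Module.finrank_pi_fintype]
    simp
  have k1 := (e.baseChange R (R ⧸ m) _ _).finrank_eq
  have k2 : 0 < Module.finrank (R ⧸ m) ((R ⧸ m) ⊗[R] T) := Module.finrank_pos_iff.2 hnt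
  rw [key M, key M'] at k1
  exact Nat.eq_of_mul_eq_mul_right k2 k1
end semi
end

open TensorProduct
noncomputable section

/-- bundled data for the proof -/
structure Dat (R A B : Type*) [CommRing R] [Ring A] [Algebra R A] [Ring B] [Algebra R B] where
  f : B →ₐ[R] A
  g : B →ₐ[R] A
  s : A →ₗ[R] A
  hs1 : s 1 = 1
  hsm : ∀ a b, s (a * b) = s b * s a
  hss : ∀ a, s (s a) = a
  τ : B →ₗ[R] B
  hτ1 : ∀ b, g (τ b) = s (f b)
  hτ2 : ∀ b, f (τ b) = s (g b)
  n : ℕ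
  x : Fin n → B
  y : Fin n → B
  hB : SepFam R x y
  n' : ℕ
  x' : Fin n' → A
  y' : Fin n' → A
  hA : SepFam R x' y'
  hS : ∀ z ∈ Subalgebra.center R A, ∃ t ∈ Subalgebra.center R B, f t = z ∧ g t = z

section bc
variable {R A B : Type*} [CommRing R] [Ring A] [Algebra R A] [Ring B] [Algebra R B]
variable (K : Type*) [CommRing K] [Algebra R K]

theorem one_surj (hK : Function.Surjective (algebraMap R K)) {M : Type*} [AddCommGroup M] [Module R M]
    (z : K ⊗[R] M) : ∃ m : M, z = 1 ⊗ₜ m := by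
  induction z with
  | zero => exact ⟨0, by simp⟩
  | tmul k m =>
    obtain ⟨r, rfl⟩ := hK k
    exact ⟨r • m, by rw [Algebra.algebraMap_eq_smul_one, TensorProduct.smul_tmul]⟩
  | add a b ha hb =>
    obtain ⟨m, rfl⟩ := ha
    obtain ⟨m', rfl⟩ := hb
    exact ⟨m + m', by rw [TensorProduct.tmul_add]⟩

theorem SepFam.bc (hK : Function.Surjective (algebraMap R K)) {n : ℕ} {x y : Fin n → B}
    (h : SepFam R x y) : SepFam K (fun i => (1 : K) ⊗ₜ[R] x i) (fun i => (1 : K) ⊗ₜ[R] y i) := by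
  constructor
  · simp only [Algebra.TensorProduct.tmul_mul_tmul, mul_one]
    rw [← TensorProduct.tmul_sum, h.1]; rfl
  · intro z
    obtain ⟨b, rfl⟩ := one_surj K hK z
    let G : B →ₗ[R] B →ₗ[R] ((K ⊗[R] B) ⊗[K] (K ⊗[R] B)) :=
      LinearMap.mk₂ R (fun b c => ((1 : K) ⊗ₜ[R] b) ⊗ₜ[K] ((1 : K) ⊗ₜ[R] c))
        (fun a b c => by simp only [TensorProduct.tmul_add, TensorProduct.add_tmul])
        (fun r b c => by rw [TensorProduct.tmul_smul]; rfl)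
        (fun a b c => by simp only [TensorProduct.tmul_add])
        (fun r b c => by
          rw [TensorProduct.tmul_smul, ← algebraMap_smul K r ((1 : K) ⊗ₜ[R] c), TensorProduct.tmul_smul,
            algebraMap_smul])
    have := h.bil G b
    simp only [G, LinearMap.mk₂_apply] at this
    simp only [Algebra.TensorProduct.tmul_mul_tmul, mul_one]
    exact this

theorem center_bc (b : B) (hK : Function.Surjective (algebraMap R K)) (hb : b ∈ Subalgebra.center R B) :
    (1 : K) ⊗ₜ[R] b ∈ Subalgebra.center K (K ⊗[R] B) := by
  rw [Subalgebra.mem_center_iff] at hb ⊢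
  intro z
  obtain ⟨c, rfl⟩ := one_surj K hK z
  simp only [Algebra.TensorProduct.tmul_mul_tmul, hb]

theorem center_lift (hK : Function.Surjective (algebraMap R K)) {n : ℕ} {x y : Fin n → B}
    (h : SepFam R x y) (z : K ⊗[R] B) (hz : z ∈ Subalgebra.center K (K ⊗[R] B)) :
    ∃ b ∈ Subalgebra.center R B, z = 1 ⊗ₜ b := by
  obtain ⟨b, rfl⟩ := one_surj K hK z
  refine ⟨∑ i, x i * b * y i, Subalgebra.mem_center_iff.2 fun c => h.central b c, ?_⟩
  rw [Subalgebra.mem_center_iff] at hz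
  have hb := h.bc K hK
  calc (1 : K) ⊗ₜ[R] b = (∑ i, ((1 : K) ⊗ₜ[R] x i) * ((1 : K) ⊗ₜ[R] y i)) * (1 ⊗ₜ b) := by
        rw [hb.1, one_mul]
    _ = ∑ i, ((1 : K) ⊗ₜ[R] x i) * (1 ⊗ₜ b) * ((1 : K) ⊗ₜ[R] y i) := by
        rw [Finset.sum_mul]
        refine Finset.sum_congr rfl fun i _ => ?_
        rw [mul_assoc, hz, mul_assoc]
    _ = _ := by
        simp only [Algebra.TensorProduct.tmul_mul_tmul, mul_one]
        rw [← TensorProduct.tmul_sum]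

/-- base change of the data -/
def Dat.bc (d : Dat R A B) (hK : Function.Surjective (algebraMap R K)) : Dat K (K ⊗[R] A) (K ⊗[R] B) where
  f := Algebra.TensorProduct.map (AlgHom.id K K) d.f
  g := Algebra.TensorProduct.map (AlgHom.id K K) d.g
  s := d.s.baseChange K
  hs1 := by
    rw [Algebra.TensorProduct.one_def, LinearMap.baseChange_tmul, d.hs1]
  hsm := fun a b => by
    obtain ⟨a, rfl⟩ := one_surj K hK a
    obtain ⟨b, rfl⟩ := one_surj K hK b
    simp only [Algebra.TensorProduct.tmul_mul_tmul, LinearMap.baseChange_tmul, d.hsm]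
  hss := fun a => by
    obtain ⟨a, rfl⟩ := one_surj K hK a
    simp only [LinearMap.baseChange_tmul, d.hss]
  τ := d.τ.baseChange K
  hτ1 := fun b => by
    obtain ⟨b, rfl⟩ := one_surj K hK b
    simp [d.hτ1]
  hτ2 := fun b => by
    obtain ⟨b, rfl⟩ := one_surj K hK b
    simp [d.hτ2]
  n := d.n
  x := fun i => 1 ⊗ₜ d.x i
  y := fun i => 1 ⊗ₜ d.y i
  hB := d.hB.bc K hK
  n' := d.n'
  x' := fun i => 1 ⊗ₜ d.x' i
  y' := fun i => 1 ⊗ₜ d.y' i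
  hA := d.hA.bc K hK
  hS := fun z hz => by
    obtain ⟨b, hb, rfl⟩ := center_lift K hK d.hA z hz
    obtain ⟨t, ht, h1, h2⟩ := d.hS b hb
    exact ⟨1 ⊗ₜ t, center_bc K t hK ht, by simp [h1], by simp [h2]⟩

/-- the space of symmetric intertwiners -/
def Dat.E (d : Dat R A B) (δ : R) : Submodule R A := Ee d.f d.g d.s δ

/-- averaging -/
def Dat.Q (d : Dat R A B) : A →ₗ[R] A :=
  ∑ i, LinearMap.mulLeft R (d.f (d.x i)) ∘ₗ LinearMap.mulRight R (d.g (d.y i))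

theorem Dat.Q_apply (d : Dat R A B) (a : A) : d.Q a = ∑ i, d.f (d.x i) * a * d.g (d.y i) := by
  simp [Dat.Q, mul_assoc]

theorem Dat.Q_mem (d : Dat R A B) (a : A) : d.Q a ∈ Ed d.f d.g := by
  intro b
  rw [Dat.Q_apply]
  have := d.hB.bil ((LinearMap.mul R A).compl₁₂ (LinearMap.mulRight R a ∘ₗ d.f.toLinearMap) d.g.toLinearMap) b
  simp only [LinearMap.compl₁₂_apply, LinearMap.mulRight_apply, LinearMap.mul_apply',
    LinearMap.comp_apply, AlgHom.toLinearMap_apply] at this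
  rw [Finset.mul_sum, Finset.sum_mul]
  simpa [mul_assoc] using this

theorem Dat.Q_eq (d : Dat R A B) (a : A) (ha : a ∈ Ed d.f d.g) : d.Q a = a := by
  rw [Dat.Q_apply]
  have : ∀ i, d.f (d.x i) * a * d.g (d.y i) = d.f (d.x i * d.y i) * a := fun i => by
    rw [mul_assoc, ← ha, map_mul, mul_assoc]
  simp only [this]
  rw [← Finset.sum_mul, ← map_sum, d.hB.1, map_one, one_mul]

theorem Dat.sE (d : Dat R A B) (h : A) (hh : h ∈ Ed d.f d.g) : d.s h ∈ Ed d.f d.g := by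
  intro b
  have := congrArg d.s (hh (d.τ b))
  rw [d.hsm, d.hsm, d.hτ1, d.hτ2, d.hss, d.hss] at this
  exact this.symm

/-- projection onto symmetric intertwiners -/
def Dat.P (d : Dat R A B) (u δ : R) : A →ₗ[R] A := u • (d.Q + δ • (d.s ∘ₗ d.Q))

theorem Dat.P_apply (d : Dat R A B) (u δ : R) (a : A) : d.P u δ a = u • (d.Q a + δ • d.s (d.Q a)) := by
  simp [Dat.P]

theorem Dat.P_mem (d : Dat R A B) (u δ : R) (hδ : δ * δ = 1) (a : A) : d.P u δ a ∈ d.E δ := by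
  rw [Dat.P_apply]
  refine Submodule.smul_mem _ _ ⟨Submodule.add_mem _ (d.Q_mem a) (Submodule.smul_mem _ _ (d.sE _ (d.Q_mem a))), ?_⟩
  rw [map_add, map_smul, d.hss, smul_add, smul_smul, hδ, one_smul, add_comm]

theorem Dat.P_eq (d : Dat R A B) (u δ : R) (hδ : δ * δ = 1) (hu : u * 2 = 1) (a : A) (ha : a ∈ d.E δ) :
    d.P u δ a = a := by
  rw [Dat.P_apply, d.Q_eq a ha.1, ha.2, smul_smul, hδ, one_smul, ← two_smul R, smul_smul, hu, one_smul]

theorem Dat.bc_f (d : Dat R A B) (hK : Function.Surjective (algebraMap R K)) (b : B) :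
    (d.bc K hK).f (1 ⊗ₜ b) = 1 ⊗ₜ d.f b := by simp [Dat.bc]
theorem Dat.bc_g (d : Dat R A B) (hK : Function.Surjective (algebraMap R K)) (b : B) :
    (d.bc K hK).g (1 ⊗ₜ b) = 1 ⊗ₜ d.g b := by simp [Dat.bc]
theorem Dat.bc_s (d : Dat R A B) (hK : Function.Surjective (algebraMap R K)) (b : A) :
    (d.bc K hK).s (1 ⊗ₜ b) = 1 ⊗ₜ d.s b := by simp [Dat.bc]
theorem Dat.bc_τ (d : Dat R A B) (hK : Function.Surjective (algebraMap R K)) (b : B) :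
    (d.bc K hK).τ (1 ⊗ₜ b) = 1 ⊗ₜ d.τ b := by simp [Dat.bc]

theorem Dat.E_bc (d : Dat R A B) (hK : Function.Surjective (algebraMap R K)) (δ : R) (a : A)
    (ha : a ∈ d.E δ) : (1 : K) ⊗ₜ[R] a ∈ (d.bc K hK).E (algebraMap R K δ) := by
  constructor
  · intro z
    obtain ⟨b, rfl⟩ := one_surj K hK z
    rw [Dat.bc_f, Dat.bc_g, Algebra.TensorProduct.tmul_mul_tmul, Algebra.TensorProduct.tmul_mul_tmul, ha.1 b]
  · rw [Dat.bc_s, ha.2, TensorProduct.tmul_smul, algebraMap_smul]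

theorem Dat.Q_bc (d : Dat R A B) (hK : Function.Surjective (algebraMap R K)) (a : A) :
    (d.bc K hK).Q (1 ⊗ₜ a) = 1 ⊗ₜ d.Q a := by
  rw [Dat.Q_apply, Dat.Q_apply, TensorProduct.tmul_sum]
  refine Finset.sum_congr rfl fun i _ => ?_
  show (d.bc K hK).f (1 ⊗ₜ d.x i) * (1 ⊗ₜ a) * (d.bc K hK).g (1 ⊗ₜ d.y i) = _
  rw [Dat.bc_f, Dat.bc_g, Algebra.TensorProduct.tmul_mul_tmul, Algebra.TensorProduct.tmul_mul_tmul]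
  simp

theorem Dat.E_lift (d : Dat R A B) (hK : Function.Surjective (algebraMap R K)) (u δ : R) (hδ : δ * δ = 1)
    (hu : u * 2 = 1) (z : K ⊗[R] A) (hz : z ∈ (d.bc K hK).E (algebraMap R K δ)) :
    ∃ a ∈ d.E δ, z = 1 ⊗ₜ a := by
  obtain ⟨a, rfl⟩ := one_surj K hK z
  refine ⟨d.P u δ a, d.P_mem u δ hδ a, ?_⟩
  have h1 := (d.bc K hK).P_eq (algebraMap R K u) (algebraMap R K δ) (by rw [← map_mul, hδ, map_one])
    (by rw [← map_ofNat (algebraMap R K) 2, ← map_mul, hu, map_one]) _ hz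
  rw [← h1, Dat.P_apply, Dat.P_apply, Dat.Q_bc, Dat.bc_s, TensorProduct.tmul_smul, TensorProduct.tmul_add,
    TensorProduct.tmul_smul, algebraMap_smul, algebraMap_smul]
end bc

section lift
variable {R A : Type*} [CommRing R] [Ring A] [Algebra R A]

theorem isUnit_of_local [Module.Finite R A] (a : A)
    (h : ∀ m : Ideal R, m.IsMaximal → IsUnit ((1 : R ⧸ m) ⊗ₜ[R] a)) : IsUnit a := by
  have hsurj : Function.Surjective (LinearMap.mulLeft R a) := by
    rw [← LinearMap.range_eq_top]
    by_contra hne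
    set N := LinearMap.range (LinearMap.mulLeft R a) with hN
    have hI : Module.annihilator R (A ⧸ N) ≠ ⊤ := by
      rw [Ne, Module.annihilator_eq_top_iff]
      intro hs
      exact hne ((Submodule.Quotient.subsingleton_iff (p := N)).1 hs)
    obtain ⟨m, hm, hle⟩ := Ideal.exists_le_maximal _ hI
    have key : (⊤ : Submodule R (A ⧸ N)) ≤ m • ⊤ := by
      rintro q -
      obtain ⟨x, rfl⟩ := N.mkQ_surjective q
      obtain ⟨w, hw⟩ := (h m hm).exists_right_inv
      obtain ⟨c, hc⟩ := one_surj (R ⧸ m) Ideal.Quotient.mk_surjective (w * (1 ⊗ₜ x))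
      have e : (1 : R ⧸ m) ⊗ₜ[R] (x - a * c) = 0 := by
        have e1 : (1 : R ⧸ m) ⊗ₜ[R] (a * c) = 1 ⊗ₜ x := by
          have : (1 : R ⧸ m) ⊗ₜ[R] (a * c) = (1 ⊗ₜ a) * (1 ⊗ₜ c) := by
            rw [Algebra.TensorProduct.tmul_mul_tmul, mul_one]
          rw [this, ← hc, ← mul_assoc, hw, one_mul]
        rw [TensorProduct.tmul_sub, e1, sub_self]
      have e2 := congrArg (TensorProduct.quotTensorEquivQuotSMul A m) e
      rw [← map_one (Ideal.Quotient.mk m), TensorProduct.quotTensorEquivQuotSMul_mk_tmul, one_smul, map_zero,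
        Submodule.Quotient.mk_eq_zero] at e2
      have e3 : N.mkQ x = N.mkQ (x - a * c) := by
        have e5 : N.mkQ (a * c) = 0 := (Submodule.Quotient.mk_eq_zero N).2 ⟨c, rfl⟩
        rw [map_sub, e5, sub_zero]
      rw [e3]
      have e4 := Submodule.mem_map_of_mem (f := N.mkQ) e2
      rw [Submodule.map_smul''] at e4
      exact Submodule.smul_mono le_rfl le_top e4
    obtain ⟨r, hr, hr0⟩ := Submodule.exists_sub_one_mem_and_smul_eq_zero_of_fg_of_le_smul m _
      (Module.Finite.fg_top) key
    have : r ∈ m := hle (Module.mem_annihilator.2 fun q => hr0 q trivial)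
    exact hm.ne_top ((Ideal.eq_top_iff_one _).2 (by simpa using m.sub_mem this hr))
  have hinj := OrzechProperty.injective_of_surjective_endomorphism _ hsurj
  obtain ⟨c, hc⟩ := hsurj 1
  simp only [LinearMap.mulLeft_apply] at hc
  have h2 : c * a = 1 := hinj (by
    simp only [LinearMap.mulLeft_apply]; rw [← mul_assoc, hc, one_mul, mul_one])
  exact ⟨⟨a, c, hc, h2⟩, rfl⟩

variable {B : Type*} [Ring B] [Algebra R B]
theorem Dat.lift_unit [Module.Finite R A] [Finite (MaximalSpectrum R)] (d : Dat R A B)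
    (u δ : R) (hδ : δ * δ = 1) (hu : u * 2 = 1)
    (h : ∀ m : Ideal R, m.IsMaximal →
      ∃ z ∈ (d.bc (R ⧸ m) Ideal.Quotient.mk_surjective).E (algebraMap R (R ⧸ m) δ), IsUnit z) :
    ∃ a ∈ d.E δ, IsUnit a := by
  have h' : ∀ m : MaximalSpectrum R, ∃ a : d.E δ, IsUnit ((1 : R ⧸ m.1) ⊗ₜ[R] (a : A)) := by
    intro m
    obtain ⟨z, hz, hzu⟩ := h m.1 m.2
    obtain ⟨a, ha, rfl⟩ := d.E_lift _ _ u δ hδ hu z hz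
    exact ⟨⟨a, ha⟩, hzu⟩
  choose a ha using h'
  obtain ⟨b, hb⟩ := Ideal.pi_tensorProductMk_quotient_surjective (R := R) (d.E δ) (fun m : MaximalSpectrum R => m.1)
    (fun _ _ ne ↦ Ideal.isCoprime_of_isMaximal (MaximalSpectrum.ext_iff.ne.mp ne)) (fun m => 1 ⊗ₜ a m)
  refine ⟨b, b.2, isUnit_of_local (R := R) (b : A) fun m hm => ?_⟩
  have e := congrFun hb ⟨m, hm⟩
  simp only [LinearMap.pi_apply, TensorProduct.mk_apply] at e
  have e1 := congrArg (LinearMap.lTensor (R ⧸ m) (d.E δ).subtype) e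
  simp only [LinearMap.lTensor_tmul, Submodule.subtype_apply] at e1
  rw [e1]
  exact ha ⟨m, hm⟩
end lift
end

open TensorProduct
noncomputable section

/-- type synonym for a twisted module -/
def Tw {R T A : Type*} [CommRing R] [CommRing T] [Algebra R T] [Ring A] [Algebra R A]
    (_k : T →ₐ[R] A) : Type _ := A

section tw
variable {R T A : Type*} [CommRing R] [CommRing T] [Algebra R T] [Ring A] [Algebra R A] (k : T →ₐ[R] A)

instance : AddCommGroup (Tw k) := inferInstanceAs (AddCommGroup A)
instance : Module R (Tw k) := inferInstanceAs (Module R A)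
instance : Module T (Tw k) := Module.compHom A k.toRingHom

theorem Tw.smul_def (t : T) (a : Tw k) : t • a = (show A from k t * (show A from a)) := rfl

instance : IsScalarTower R T (Tw k) := ⟨fun r t a => by
  show (k (r • t) * (show A from a) : A) = r • (k t * (show A from a) : A)
  rw [map_smul, smul_mul_assoc]⟩
instance [h : Module.Finite R A] : Module.Finite R (Tw k) := h
instance [h : Module.Projective R A] : Module.Projective R (Tw k) := h

theorem theta [Module.Finite R T]
    [Algebra.FormallyUnramified R T] [Finite (MaximalSpectrum R)] [Nontrivial T]
    (hc : ∀ e : T, IsIdempotentElem e → e = 0 ∨ e = 1) [Module.Finite R A] [Module.Projective R A]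
    (kf kg : T →ₐ[R] A) : ∃ θ : A ≃ₗ[R] A, ∀ t x, θ (kg t * x) = kf t * θ x := by
  let e : Tw kg ≃ₗ[R] Tw kf := LinearEquiv.refl R A
  obtain ⟨θ⟩ := equiv_of_equiv R T hc (Tw kg) (Tw kf) e
  exact ⟨(θ.restrictScalars R : Tw kg ≃ₗ[R] Tw kf), fun t x => θ.map_smul t x⟩

theorem exists_split [Nontrivial T] (M M' : Type*) [AddCommGroup M] [Module T M] [AddCommGroup M'] [Module T M']
    [Module.Free T M] [Module.Finite T M] [Module.Free T M'] [Module.Finite T M']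
    (h : Module.finrank T M ≤ Module.finrank T M') :
    ∃ (i : M →ₗ[T] M') (j : M' →ₗ[T] M), ∀ m, j (i m) = m := by
  let b := Module.finBasis T M
  let b' := Module.finBasis T M'
  refine ⟨b.constr T (fun i => b' (Fin.castLE h i)),
    b'.constr T (fun i => if hi : i.1 < Module.finrank T M then b ⟨i.1, hi⟩ else 0), ?_⟩
  intro m
  have : (b'.constr T (fun i => if hi : i.1 < Module.finrank T M then b ⟨i.1, hi⟩ else 0)) ∘ₗ
    (b.constr T (fun i => b' (Fin.castLE h i))) = LinearMap.id := by
    refine b.ext fun i => ?_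
    simp only [LinearMap.comp_apply, Module.Basis.constr_basis, LinearMap.id_apply, Fin.val_castLE, i.2, dite_true]
  exact LinearMap.congr_fun this m
end tw

section glob
variable {R A B : Type*} [CommRing R] [Ring A] [Algebra R A] [Ring B] [Algebra R B]

theorem E_smul (d : Dat R A B) (hst : ∀ t ∈ Subalgebra.center R B, d.g t = d.s (d.f t)) (δ : R)
    (t : B) (ht : t ∈ Subalgebra.center R B) (a : A) (ha : a ∈ d.E δ) : d.f t * a ∈ d.E δ := by
  have ht' := Subalgebra.mem_center_iff.1 ht
  constructor
  · intro b
    rw [← mul_assoc, ← map_mul, ht', map_mul, mul_assoc, ha.1 b, mul_assoc]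
  · rw [d.hsm, ← hst t ht, ha.2, smul_mul_assoc, ← ha.1 t]

variable {T : Type*} [CommRing T] [Algebra R T] [Algebra T B] [IsScalarTower R T B]

/-- symmetric intertwiners over the center -/
def EE (d : Dat R A B) (hst : ∀ t ∈ Subalgebra.center R B, d.g t = d.s (d.f t)) (δ : R) :
    Submodule T (Tw (d.f.comp (IsScalarTower.toAlgHom R T B))) where
  carrier := {a | (show A from a) ∈ d.E δ}
  add_mem' := fun {x y} hx hy => (d.E δ).add_mem hx hy
  zero_mem' := (d.E δ).zero_mem
  smul_mem' := fun t a ha => E_smul d hst δ (algebraMap T B t)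
    (Subalgebra.mem_center_iff.2 fun b => (Algebra.commutes t b).symm) a ha

/-- projection -/
def EP (d : Dat R A B) (hst : ∀ t ∈ Subalgebra.center R B, d.g t = d.s (d.f t)) (u δ : R)
    (hδ : δ * δ = 1) : A →ₗ[R] EE (T := T) d hst δ where
  toFun a := ⟨d.P u δ a, d.P_mem u δ hδ a⟩
  map_add' a b := Subtype.ext ((d.P u δ).map_add a b)
  map_smul' r a := Subtype.ext ((d.P u δ).map_smul r a)

theorem lam [Module.Finite R T]
    [Algebra.FormallyUnramified R T] [Finite (MaximalSpectrum R)] [Nontrivial T]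
    (hc : ∀ e : T, IsIdempotentElem e → e = 0 ∨ e = 1) [Module.Finite R A] [Module.Projective R A]
    (hcen : ∀ b : B, (∀ c, c * b = b * c) → ∃ t : T, algebraMap T B t = b)
    (d : Dat R A B) (hst : ∀ t ∈ Subalgebra.center R B, d.g t = d.s (d.f t)) (u : R) (hu : u * 2 = 1) :
    ∃ δ : R, (δ = 1 ∨ δ = -1) ∧ ∃ l l' : A →ₗ[R] A, ∀ a ∈ d.E (-δ), l a ∈ d.E δ ∧ l' (l a) = a ∧
      ∀ t ∈ Subalgebra.center R B, l (d.f t * a) = d.f t * l a := by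
  have := semilocal_finite R T
  have hfr : ∀ δ : R, δ * δ = 1 → Module.Finite T (EE (T := T) d hst δ) ∧ Module.Free T (EE (T := T) d hst δ) := by
    intro δ hδ
    let p : Tw (d.f.comp (IsScalarTower.toAlgHom R T B)) →ₗ[R] EE (T := T) d hst δ := EP (T := T) d hst u δ hδ
    let i : EE (T := T) d hst δ →ₗ[R] Tw (d.f.comp (IsScalarTower.toAlgHom R T B)) :=
      (EE (T := T) d hst δ).subtype.restrictScalars R
    have hpi : ∀ z, p (i z) = z := fun z => Subtype.ext (d.P_eq u δ hδ hu _ z.2)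
    have : Module.Finite R (EE (T := T) d hst δ) := Module.Finite.of_surjective p (fun z => ⟨i z, hpi z⟩)
    have : Module.Projective R (EE (T := T) d hst δ) :=
      Module.Projective.of_split i p (LinearMap.ext hpi)
    have h1 : Module.Finite T (EE (T := T) d hst δ) := Module.Finite.of_restrictScalars_finite R T _
    have : Module.Projective T (EE (T := T) d hst δ) :=
      Algebra.FormallyUnramified.projective_of_restrictScalars R T _
    exact ⟨h1, free_of_conn T hc _⟩
  have main : ∀ δ : R, δ * δ = 1 →
      Module.finrank T (EE (T := T) d hst (-δ)) ≤ Module.finrank T (EE (T := T) d hst δ) →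
      ∃ l l' : A →ₗ[R] A, ∀ a ∈ d.E (-δ), l a ∈ d.E δ ∧ l' (l a) = a ∧
      ∀ t ∈ Subalgebra.center R B, l (d.f t * a) = d.f t * l a := by
    intro δ hδ hle
    have hδ' : -δ * -δ = 1 := by rw [neg_mul_neg, hδ]
    obtain ⟨_, _⟩ := hfr δ hδ
    obtain ⟨_, _⟩ := hfr (-δ) hδ'
    obtain ⟨i, j, hij⟩ := exists_split (T := T) (EE (T := T) d hst (-δ)) (EE (T := T) d hst δ) hle
    let vv : ∀ δ : R, EE (T := T) d hst δ →ₗ[R] A := fun δ =>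
      ((EE (T := T) d hst δ).subtype.restrictScalars R :
        EE (T := T) d hst δ →ₗ[R] Tw (d.f.comp (IsScalarTower.toAlgHom R T B)))
    have hpi : ∀ (δ : R) (hδ : δ * δ = 1) z, EP (T := T) d hst u δ hδ (vv δ z) = z :=
      fun δ hδ z => Subtype.ext (d.P_eq u δ hδ hu _ z.2)
    refine ⟨vv δ ∘ₗ i.restrictScalars R ∘ₗ EP d hst u (-δ) hδ',
      vv (-δ) ∘ₗ j.restrictScalars R ∘ₗ EP d hst u δ hδ, ?_⟩
    intro a ha
    obtain ⟨z, rfl⟩ : ∃ z : EE (T := T) d hst (-δ), vv (-δ) z = a := ⟨⟨a, ha⟩, rfl⟩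
    refine ⟨?_, ?_, ?_⟩
    · exact (i _).2
    · simp only [LinearMap.comp_apply, hpi, LinearMap.restrictScalars_apply, hij]
    · intro t ht
      obtain ⟨t, rfl⟩ := hcen t (Subalgebra.mem_center_iff.1 ht)
      have e : d.f (algebraMap T B t) * vv (-δ) z = vv (-δ) (t • z) := rfl
      rw [e]
      simp only [LinearMap.comp_apply, hpi, LinearMap.restrictScalars_apply, map_smul]
      rfl
  rcases le_total (Module.finrank T (EE (T := T) d hst (-1))) (Module.finrank T (EE (T := T) d hst 1)) with h | h
  · exact ⟨1, Or.inl rfl, main 1 (by simp) h⟩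
  · exact ⟨-1, Or.inr rfl, main (-1) (by simp) (by rwa [neg_neg])⟩

theorem exists_uv [Module.Finite R B] (hinj : Function.Injective (algebraMap T B))
    (hcen : ∀ b : B, (∀ c, c * b = b * c) → ∃ t : T, algebraMap T B t = b)
    (hc : ∀ e : T, IsIdempotentElem e → e = 0 ∨ e = 1) 
    {n : ℕ} {x y : Fin n → B} (h : SepFam R x y) (τ : T →ₐ[R] T) (hne : ∃ t, τ t ≠ t) :
    ∃ (m : ℕ) (u v : Fin m → T), ∑ i, u i * (v i - τ (v i)) = 1 := by
  obtain ⟨e, he, he1⟩ := sepCenter hinj hcen h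
  let Φ : T ⊗[R] T →ₐ[R] T := Algebra.TensorProduct.lift (AlgHom.id R T) τ (fun _ _ => Commute.all _ _)
  have hΦt : ∀ a b, Φ (a ⊗ₜ b) = a * τ b := fun a b => Algebra.TensorProduct.lift_tmul _ _ _ _ _
  have hq : ∀ s, τ s * Φ e = s * Φ e := by
    intro s
    have := congrArg Φ (he s)
    rw [map_mul, map_zero, map_sub, sub_mul, sub_eq_zero] at this
    simpa [hΦt] using this
  have hΦ : ∀ z : T ⊗[R] T, Φ z * Φ e = Algebra.TensorProduct.lmul' R z * Φ e := by
    intro z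
    induction z with
    | zero => simp
    | tmul a b => 
      rw [hΦt, Algebra.TensorProduct.lmul'_apply_tmul]
      rw [mul_assoc, hq, mul_assoc]
    | add a b ha hb => rw [map_add, map_add, add_mul, add_mul, ha, hb]
  have h0 : Φ e = 0 := by
    rcases hc (Φ e) (by rw [IsIdempotentElem, hΦ, he1, one_mul]) with h | h
    · exact h
    · obtain ⟨t, ht⟩ := hne
      have := hq t
      rw [h, mul_one, mul_one] at this
      exact absurd this ht
  obtain ⟨n, x, y, rfl⟩ : ∃ (n : ℕ) (x y : Fin n → T), e = ∑ i, x i ⊗ₜ[R] y i := by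
    obtain ⟨S, hS⟩ := TensorProduct.exists_finset e
    refine ⟨S.card, fun i => (S.equivFin.symm i).1.1, fun i => (S.equivFin.symm i).1.2, ?_⟩
    rw [hS, ← Finset.sum_coe_sort, ← S.equivFin.symm.sum_comp]
  refine ⟨n, x, y, ?_⟩
  have e1 : ∑ i, x i * y i = 1 := by simpa using he1
  have e2 : ∑ i, x i * τ (y i) = 0 := by simpa [hΦt] using h0
  simp only [mul_sub, Finset.sum_sub_distrib, e1, e2, sub_zero]
end glob

section loc
variable {R A B : Type*} [CommRing R] [Ring A] [Algebra R A] [Ring B] [Algebra R B]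
variable (K : Type*) [Field K] [Algebra R K] 

theorem hr_bc (d : Dat R A B) (hK : Function.Surjective (algebraMap R K)) (θ : A ≃ₗ[R] A)
    (hθ : ∀ t ∈ Subalgebra.center R B, ∀ x, θ (d.g t * x) = d.f t * θ x)
    (t : K ⊗[R] B) (ht0 : t ∈ Subalgebra.center K (K ⊗[R] B)) :
    Module.finrank K (LinearMap.range (LinearMap.mulLeft K ((d.bc K hK).f t)))
      = Module.finrank K (LinearMap.range (LinearMap.mulLeft K ((d.bc K hK).g t))) := by
  obtain ⟨t, ht, rfl⟩ := center_lift K hK d.hB t ht0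
  let Θ : (K ⊗[R] A) ≃ₗ[K] (K ⊗[R] A) := θ.baseChange R K A A
  have hΘ : ∀ a : A, Θ (1 ⊗ₜ a) = 1 ⊗ₜ θ a := fun a => by simp [Θ]
  have : LinearMap.mulLeft K ((d.bc K hK).f (1 ⊗ₜ t)) ∘ₗ Θ.toLinearMap =
      Θ.toLinearMap ∘ₗ LinearMap.mulLeft K ((d.bc K hK).g (1 ⊗ₜ t)) := by
    refine LinearMap.ext fun z => ?_
    obtain ⟨a, rfl⟩ := one_surj K hK z
    simp [Dat.bc_f, Dat.bc_g, hΘ, hθ t ht]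
  have e1 : LinearMap.range (LinearMap.mulLeft K ((d.bc K hK).f (1 ⊗ₜ t))) =
      (LinearMap.range (LinearMap.mulLeft K ((d.bc K hK).g (1 ⊗ₜ t)))).map Θ.toLinearMap := by
    rw [← LinearMap.range_comp, ← this, LinearMap.range_comp_of_range_eq_top _ (LinearEquiv.range Θ)]
  rw [e1]
  exact LinearEquiv.finrank_map_eq Θ _

theorem hrank_bc [Module.Finite R A] (d : Dat R A B) (hK : Function.Surjective (algebraMap R K))
    (u δ : R) (hδ : δ * δ = 1) (hu : u * 2 = 1) 
    (hst : ∀ t ∈ Subalgebra.center R B, d.g t = d.s (d.f t)) 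
    (l l' : A →ₗ[R] A) (hl : ∀ a ∈ d.E (-δ), l a ∈ d.E δ ∧ l' (l a) = a ∧
      ∀ t ∈ Subalgebra.center R B, l (d.f t * a) = d.f t * l a)
    (t : K ⊗[R] B) (ht0 : t ∈ Subalgebra.center K (K ⊗[R] B)) :
    Module.finrank K (((d.bc K hK).E (-algebraMap R K δ)).map (LinearMap.mulLeft K ((d.bc K hK).f t))) ≤
      Module.finrank K (((d.bc K hK).E (algebraMap R K δ)).map (LinearMap.mulLeft K ((d.bc K hK).f t))) := by
  obtain ⟨t, ht, rfl⟩ := center_lift K hK d.hB t ht0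
  have key : ∀ z ∈ ((d.bc K hK).E (-algebraMap R K δ)).map (LinearMap.mulLeft K ((d.bc K hK).f (1 ⊗ₜ t))),
      l.baseChange K z ∈ ((d.bc K hK).E (algebraMap R K δ)).map (LinearMap.mulLeft K ((d.bc K hK).f (1 ⊗ₜ t)))
      ∧ l'.baseChange K (l.baseChange K z) = z := by
    rintro _ ⟨z, hz, rfl⟩
    have hz' : z ∈ (d.bc K hK).E (algebraMap R K (-δ)) := by rw [map_neg]; exact hz
    obtain ⟨a, ha, rfl⟩ := d.E_lift K hK u (-δ) (by rw [neg_mul_neg, hδ]) hu z hz'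
    rw [LinearMap.mulLeft_apply, Dat.bc_f, Algebra.TensorProduct.tmul_mul_tmul, mul_one]
    obtain ⟨h1, h2, h3⟩ := hl a ha
    obtain ⟨-, h4, -⟩ := hl _ (E_smul d hst _ t ht a ha)
    constructor
    · refine ⟨1 ⊗ₜ l a, d.E_bc K hK δ _ h1, ?_⟩
      rw [LinearMap.mulLeft_apply, Algebra.TensorProduct.tmul_mul_tmul, mul_one,
        LinearMap.baseChange_tmul, h3 t ht]
    · rw [LinearMap.baseChange_tmul, LinearMap.baseChange_tmul, h4]
  set S := ((d.bc K hK).E (-algebraMap R K δ)).map (LinearMap.mulLeft K ((d.bc K hK).f (1 ⊗ₜ t)))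
  have e1 : S = (S.map (l.baseChange K)).map (l'.baseChange K) := by
    apply le_antisymm
    · intro z hz
      exact ⟨_, ⟨z, hz, rfl⟩, (key z hz).2⟩
    · rintro _ ⟨_, ⟨z, hz, rfl⟩, rfl⟩
      rw [(key z hz).2]; exact hz
  calc Module.finrank K S ≤ Module.finrank K (S.map (l.baseChange K)) := by
        conv_lhs => rw [e1]
        exact Submodule.finrank_map_le _ _
    _ ≤ _ := Submodule.finrank_mono (by
        rintro _ ⟨z, hz, rfl⟩
        exact (key z hz).1)
end loc

section fin
variable {R A B : Type*} [CommRing R] [Ring A] [Algebra R A] [Ring B] [Algebra R B]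
  {T : Type*} [CommRing T] [Algebra R T] [Algebra T B] [IsScalarTower R T B]
  [Finite (MaximalSpectrum R)] [Nontrivial T] [Module.Finite R A] [Module.Projective R A]
  [Module.Finite R B]

theorem two_ne {u : R} (hu : u * 2 = 1) (m : Ideal R) (hm : m.IsMaximal) : (2 : R ⧸ m) ≠ 0 := by
  intro h
  have := congrArg (Ideal.Quotient.mk m) hu
  rw [map_mul, map_ofNat, h, mul_zero, map_one] at this
  have := Ideal.Quotient.nontrivial_iff.2 hm.ne_top
  exact zero_ne_one ‹_›

theorem main_V (hinj : Function.Injective (algebraMap T B))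
    (hcen : ∀ b : B, (∀ c, c * b = b * c) → ∃ t : T, algebraMap T B t = b)
    (hc : ∀ e : T, IsIdempotentElem e → e = 0 ∨ e = 1) (d : Dat R A B) (u : R) (hu : u * 2 = 1)
    (hst : ∀ t ∈ Subalgebra.center R B, d.g t = d.s (d.f t)) :
    ∃ δ : R, (δ = 1 ∨ δ = -1) ∧ ∃ a ∈ d.E δ, IsUnit a := by
  obtain ⟨_, _⟩ := center_unramified hinj hcen d.hB
  obtain ⟨δ, hδ, l, l', hl⟩ := lam hc hcen d hst u hu
  have hδ' : δ * δ = 1 := by rcases hδ with rfl | rfl <;> simp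
  obtain ⟨θ, hθ⟩ := theta hc (d.f.comp (IsScalarTower.toAlgHom R T B)) (d.g.comp (IsScalarTower.toAlgHom R T B))
  refine ⟨δ, hδ, d.lift_unit u δ hδ' hu fun m hm => ?_⟩
  let _ := Ideal.Quotient.field m
  have hK : Function.Surjective (algebraMap R (R ⧸ m)) := Ideal.Quotient.mk_surjective
  refine field_caseV (d.bc (R ⧸ m) hK).hB (d.bc (R ⧸ m) hK).hA (d.bc (R ⧸ m) hK).f (d.bc (R ⧸ m) hK).g
    (d.bc (R ⧸ m) hK).hS (d.bc (R ⧸ m) hK).s (d.bc (R ⧸ m) hK).hs1 (d.bc (R ⧸ m) hK).hsm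
    (d.bc (R ⧸ m) hK).hss (fun b => ⟨_, (d.bc (R ⧸ m) hK).hτ1 b, (d.bc (R ⧸ m) hK).hτ2 b⟩)
    (hr_bc (R ⧸ m) d hK θ ?_) (two_ne hu m hm) _ (by rw [← map_mul, hδ', map_one]) ?_
    (hrank_bc (R ⧸ m) d hK u δ hδ' hu hst l l' hl)
  · intro t ht x
    obtain ⟨t, rfl⟩ := hcen t (Subalgebra.mem_center_iff.1 ht)
    exact hθ t x
  · intro t ht0
    obtain ⟨t, ht, rfl⟩ := center_lift (R ⧸ m) hK d.hB t ht0
    rw [Dat.bc_f, Dat.bc_g, Dat.bc_s, hst t ht]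

theorem main_IV (hinj : Function.Injective (algebraMap T B))
    (hcen : ∀ b : B, (∀ c, c * b = b * c) → ∃ t : T, algebraMap T B t = b)
    (hc : ∀ e : T, IsIdempotentElem e → e = 0 ∨ e = 1) (d : Dat R A B) (u : R) (hu : u * 2 = 1)
    (τ : T →ₐ[R] T) (hτ : ∀ t, algebraMap T B (τ t) = d.τ (algebraMap T B t)) (hne : ∃ t, τ t ≠ t)
    (δ : R) (hδ : δ * δ = 1) : ∃ a ∈ d.E δ, IsUnit a := by
  obtain ⟨_, _⟩ := center_unramified hinj hcen d.hB
  obtain ⟨θ, hθ⟩ := theta hc (d.f.comp (IsScalarTower.toAlgHom R T B)) (d.g.comp (IsScalarTower.toAlgHom R T B))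
  obtain ⟨k, p, q, hpq⟩ := exists_uv hinj hcen hc d.hB τ hne
  refine d.lift_unit u δ hδ hu fun m hm => ?_
  let _ := Ideal.Quotient.field m
  have hK : Function.Surjective (algebraMap R (R ⧸ m)) := Ideal.Quotient.mk_surjective
  refine field_caseIV (d.bc (R ⧸ m) hK).hB (d.bc (R ⧸ m) hK).hA (d.bc (R ⧸ m) hK).f (d.bc (R ⧸ m) hK).g
    (d.bc (R ⧸ m) hK).hS (d.bc (R ⧸ m) hK).s (d.bc (R ⧸ m) hK).hs1 (d.bc (R ⧸ m) hK).hsm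
    (d.bc (R ⧸ m) hK).hss (d.bc (R ⧸ m) hK).τ (d.bc (R ⧸ m) hK).hτ1 (d.bc (R ⧸ m) hK).hτ2
    (hr_bc (R ⧸ m) d hK θ ?_) _ (by rw [← map_mul, hδ, map_one])
    (fun i => 1 ⊗ₜ algebraMap T B (p i)) (fun i => 1 ⊗ₜ algebraMap T B (q i)) ?_ ?_
  · intro t ht x
    obtain ⟨t, rfl⟩ := hcen t (Subalgebra.mem_center_iff.1 ht)
    exact hθ t x
  · intro i
    exact center_bc _ _ hK (Subalgebra.mem_center_iff.2 fun b => (Algebra.commutes _ b).symm)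
  · simp only [Dat.bc_τ, ← hτ, ← TensorProduct.tmul_sub, ← map_sub, Algebra.TensorProduct.tmul_mul_tmul,
      mul_one, ← map_mul]
    rw [← TensorProduct.tmul_sum, ← map_sum, hpq, map_one]
    rfl
end fin
end

/-- **Extending involutions up to conjugation (Theorem on involution extension).**
Let `R` be a connected semilocal commutative ring with `2` invertible, `(A,σ)` an Azumaya
`R`-algebra with involution, `S = Cent(A)`, and `B` an `S`-subalgebra of `A` which is
separable projective over `R` with connected center `T`.  If `τ` is an involution of `B`
with `τ|_S = σ|_S`, then there exist `ε ∈ {±1}` and a unit `a ∈ A^×` with `σ(a) = ε a` such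
that `τ = Int(a) ∘ σ|_B`.  Moreover, if `τ|_T ≠ id`, each sign `ε ∈ {±1}` can be realized. -/
theorem involution_extension_conjugation
    (R : Type) [CommRing R] (A : Type) [Ring A] [Algebra R A]
    (hsemi : IsSemilocalRing R) (hconn : IsConnectedRing R)
    (h2 : IsUnit (2 : R))
    (σ : RingInvolution A) (hAz : IsAzumayaAlgebraWithInvolution R A σ)
    (B : Subalgebra R A)
    (hSB : Subalgebra.center R A ≤ B)
    (hBsep : IsSeparableAlgebra R B)
    (hBfin : Module.Finite R B) (hBproj : Module.Projective R B)
    (hBcenterConn :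
      (0 : B) ≠ 1 ∧
      ∀ b : B, IsIdempotentElem b → (∀ c : B, b * c = c * b) → b = 0 ∨ b = 1)
    (τ : RingInvolution B)
    (hτS : ∀ x : B, (x : A) ∈ Subalgebra.center R A → ((τ.toFun x : B) : A) = σ.toFun x) :
    (∃ a : Aˣ, (σ.toFun ↑a = (↑a : A) ∨ σ.toFun ↑a = -(↑a : A)) ∧
        ∀ b : B, ((τ.toFun b : B) : A) = ↑a * σ.toFun ↑b * ↑a⁻¹) ∧
    ((∃ t : B, (∀ c : B, t * c = c * t) ∧ τ.toFun t ≠ t) →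
      ((∃ a : Aˣ, σ.toFun ↑a = (↑a : A) ∧
          ∀ b : B, ((τ.toFun b : B) : A) = ↑a * σ.toFun ↑b * ↑a⁻¹) ∧
       (∃ a : Aˣ, σ.toFun ↑a = -(↑a : A) ∧
          ∀ b : B, ((τ.toFun b : B) : A) = ↑a * σ.toFun ↑b * ↑a⁻¹))) := by
  obtain ⟨hAsep, hAfin, hAproj, hlin, -, -⟩ := hAz
  obtain ⟨u, hu⟩ := h2.exists_left_inv
  have hfinR : Finite (MaximalSpectrum R) := by
    have : Finite {I : Ideal R | I.IsMaximal} := hsemi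
    exact Finite.of_injective (fun m : MaximalSpectrum R => (⟨m.1, m.2⟩ : {I : Ideal R | I.IsMaximal}))
      (fun a b h => MaximalSpectrum.ext (congrArg (fun z => z.1) h))
  obtain ⟨n, x, y, hBf⟩ := hBsep.exists_fam
  obtain ⟨n', x', y', hAf⟩ := hAsep.exists_fam
  have hσr : ∀ r, σ.toFun (algebraMap R A r) = algebraMap R A r := fun r => by
    rw [Algebra.algebraMap_eq_smul_one, hlin, σ.map_one']
  have hτr : ∀ r, τ.toFun (algebraMap R B r) = algebraMap R B r := fun r => by
    apply Subtype.ext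
    rw [hτS _ (by exact (Subalgebra.center R A).algebraMap_mem r)]
    exact hσr r
  have hτl : ∀ (r : R) (b : B), τ.toFun (r • b) = r • τ.toFun b := fun r b => by
    rw [Algebra.smul_def, τ.map_mul', hτr, Algebra.smul_def, Algebra.commutes]
  have hτcen : ∀ t : B, t ∈ Subalgebra.center R B → τ.toFun t ∈ Subalgebra.center R B := by
    intro t ht
    rw [Subalgebra.mem_center_iff] at ht ⊢
    intro b
    have := congrArg τ.toFun (ht (τ.toFun b))
    rw [τ.map_mul', τ.map_mul', τ.invol'] at this
    exact this.symm
  let σl : A →ₗ[R] A := { toFun := σ.toFun, map_add' := σ.map_add', map_smul' := hlin }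
  let τl : B →ₗ[R] B := { toFun := τ.toFun, map_add' := τ.map_add', map_smul' := hτl }
  let g : B →ₐ[R] A := AlgHom.ofLinearMap (σl ∘ₗ B.val.toLinearMap ∘ₗ τl)
    (by show σ.toFun ((τ.toFun 1 : B) : A) = 1
        rw [τ.map_one']; exact σ.map_one')
    (fun a b => by
      show σ.toFun ((τ.toFun (a * b) : B) : A) = σ.toFun ((τ.toFun a : B) : A) * σ.toFun ((τ.toFun b : B) : A)
      rw [τ.map_mul']
      exact σ.map_mul' _ _)
  have hg : ∀ b : B, g b = σ.toFun ((τ.toFun b : B) : A) := fun b => rfl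
  let d : Dat R A B :=
    { f := B.val, g := g, s := σl, hs1 := σ.map_one', hsm := σ.map_mul', hss := σ.invol', τ := τl
      hτ1 := fun b => by
        show σ.toFun ((τ.toFun (τ.toFun b) : B) : A) = σ.toFun (b : A)
        rw [τ.invol']
      hτ2 := fun b => by
        show ((τ.toFun b : B) : A) = σ.toFun (σ.toFun ((τ.toFun b : B) : A))
        rw [σ.invol']
      n := n, x := x, y := y, hB := hBf, n' := n', x' := x', y' := y', hA := hAf
      hS := fun z hz => by
        refine ⟨⟨z, hSB hz⟩, ?_, rfl, ?_⟩
        · rw [Subalgebra.mem_center_iff] at hz ⊢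
          exact fun b => Subtype.ext (hz b)
        · rw [hg, hτS _ (by exact hz), σ.invol'] }
  let cT : Subalgebra.center R B →+* B := (Subalgebra.center R B).subtype
  let _ : Algebra (Subalgebra.center R B) B :=
    cT.toAlgebra' (fun c b => (Subalgebra.mem_center_iff.1 c.2 b).symm)
  have _ : @IsScalarTower R (Subalgebra.center R B) B _ Algebra.toSMul _ := IsScalarTower.of_algebraMap_eq fun r => rfl
  have hinj : Function.Injective (algebraMap (Subalgebra.center R B) B) := Subtype.val_injective
  have hcen : ∀ b : B, (∀ c, c * b = b * c) → ∃ t : Subalgebra.center R B,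
      algebraMap (Subalgebra.center R B) B t = b :=
    fun b hb => ⟨⟨b, Subalgebra.mem_center_iff.2 hb⟩, rfl⟩
  have hc : ∀ e : Subalgebra.center R B, IsIdempotentElem e → e = 0 ∨ e = 1 := by
    intro e he
    rcases hBcenterConn.2 e.1 (congrArg Subtype.val he)
      (fun c => (Subalgebra.mem_center_iff.1 e.2 c).symm) with h | h
    · exact Or.inl (Subtype.ext h)
    · exact Or.inr (Subtype.ext h)
  have _ : Nontrivial (Subalgebra.center R B) :=
    ⟨0, 1, fun h => hBcenterConn.1 (congrArg Subtype.val h)⟩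
  have fin : ∀ a : Aˣ, (∀ b : B, (b : A) * a = a * g b) →
      ∀ b : B, ((τ.toFun b : B) : A) = ↑a * σ.toFun ↑b * ↑a⁻¹ := by
    intro a ha b
    have := ha (τ.toFun b)
    rw [hg, τ.invol'] at this
    rw [← this, mul_assoc, Units.mul_inv, mul_one]
  have caseIV : (∃ t : B, (∀ c : B, t * c = c * t) ∧ τ.toFun t ≠ t) → ∀ δ : R, δ * δ = 1 →
      ∃ a : Aˣ, σ.toFun ↑a = δ • (↑a : A) ∧
          ∀ b : B, ((τ.toFun b : B) : A) = ↑a * σ.toFun ↑b * ↑a⁻¹ := by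
    rintro ⟨t, ht, hne⟩ δ hδ
    let τT : Subalgebra.center R B →ₐ[R] Subalgebra.center R B :=
      { toFun := fun t => ⟨τ.toFun t.1, hτcen _ t.2⟩
        map_one' := Subtype.ext τ.map_one'
        map_mul' := fun a b => by
          rw [mul_comm a b]
          exact Subtype.ext (τ.map_mul' _ _)
        map_zero' := Subtype.ext τl.map_zero
        map_add' := fun a b => Subtype.ext (τ.map_add' _ _)
        commutes' := fun r => Subtype.ext (hτr r) }
    obtain ⟨a, ha, ⟨a, rfl⟩⟩ := main_IV hinj hcen hc d u hu τT (fun _ => rfl)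
      ⟨⟨t, Subalgebra.mem_center_iff.2 fun c => (ht c).symm⟩, fun h => hne (congrArg Subtype.val h)⟩ δ hδ
    exact ⟨a, ha.2, fin a ha.1⟩
  refine ⟨?_, fun h => ⟨?_, ?_⟩⟩
  · by_cases hne : ∃ t : B, (∀ c : B, t * c = c * t) ∧ τ.toFun t ≠ t
    · obtain ⟨a, h1, h3⟩ := caseIV hne 1 (one_mul 1)
      exact ⟨a, Or.inl (by rw [h1, one_smul]), h3⟩
    · push Not at hne
      obtain ⟨δ, hδ, a, ha, ⟨a, rfl⟩⟩ := main_V hinj hcen hc d u hu (fun t ht => by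
        show σ.toFun ((τ.toFun t : B) : A) = σ.toFun (t : A)
        rw [hne t fun c => (Subalgebra.mem_center_iff.1 ht c).symm])
      refine ⟨a, ?_, fin a ha.1⟩
      have h1 : σ.toFun ↑a = δ • (↑a : A) := ha.2
      rcases hδ with rfl | rfl
      · exact Or.inl (by rw [h1, one_smul])
      · exact Or.inr (by rw [h1, neg_smul, one_smul])
  · obtain ⟨a, h1, h3⟩ := caseIV h 1 (one_mul 1)
    exact ⟨a, by rw [h1, one_smul], h3⟩
  · obtain ⟨a, h1, h3⟩ := caseIV h (-1) (by simp)
    exact ⟨a, by rw [h1, neg_smul, one_smul], h3⟩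


end
end
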